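/- arXiv:2509.17518 — 3 statements merged into one kernel-verified Lean document; each statement's English description precedes it below -/
import Mathlib

section
/- Convergence of the rescaled double time integral (equation 4.8): for d ∈ {1,2,3}, α ∈ (d/2, min(d,2)) and t > 0, the double integral ∫_0^t ∫_0^t f_{s+v}^{d,α}(0) ds dv is finite, and lim_{N→+∞} N^{d/α} · ∫_0^t ∫_0^t p_{(s+v)N}^{d,α}(0,0) ds dv = ∫_0^t ∫_0^t f_{s+v}^{d,α}(0) ds dv, where the limit is taken as the real parameter N tends to +∞. -/
open MeasureTheory Filter Real Topology

/-- Euclidean (l²) norm of a vector in `Fin d → ℝ`. -/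
noncomputable def l2norm {d : ℕ} (u : Fin d → ℝ) : ℝ := Real.sqrt (∑ i, u i ^ 2)

/-- Euclidean norm of a lattice point. -/
noncomputable def zl2 {d : ℕ} (y : Fin d → ℤ) : ℝ := l2norm (fun i => (y i : ℝ))

/-- The symbol `Σ_{y ≠ 0} (cos(θ·y) − 1)/‖y‖₂^{d+α}` of the long-range random walk. -/
noncomputable def latticeSymbol (d : ℕ) (α : ℝ) (θ : Fin d → ℝ) : ℝ :=
  ∑' y : {y : Fin d → ℤ // y ≠ 0},
    (Real.cos (∑ i, θ i * (y.1 i : ℝ)) - 1) / zl2 y.1 ^ ((d : ℝ) + α)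

/-- Transition probability `p_t^{d,α}(0,x)` of the long-range random walk, defined through
the Fourier inversion formula. -/
noncomputable def pTrans (d : ℕ) (α : ℝ) (t : ℝ) (x : Fin d → ℤ) : ℝ :=
  ((2 * Real.pi) ^ d)⁻¹ *
    ∫ θ in Set.univ.pi (fun _ : Fin d => Set.Icc (-Real.pi) Real.pi),
      Real.exp (t * latticeSymbol d α θ) * Real.cos (∑ i, (x i : ℝ) * θ i)

/-- The constant `G̃^{d,α} = ∫_{R^d} (1 − cos v₁)/‖v‖₂^{d+α} dv`. -/
noncomputable def Gtilde (d : ℕ) (α : ℝ) : ℝ :=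
  ∫ v : Fin d → ℝ, (1 - Real.cos (if h : 0 < d then v ⟨0, h⟩ else 0)) / l2norm v ^ ((d : ℝ) + α)

/-- The density `f_t^{d,α}` of the limiting stable law (case `0 < α < 2`). -/
noncomputable def fDensity (d : ℕ) (α : ℝ) (t : ℝ) (u : Fin d → ℝ) : ℝ :=
  ((2 * Real.pi) ^ d)⁻¹ *
    ∫ θ : Fin d → ℝ, Real.cos (∑ i, θ i * u i) * Real.exp (-(t * l2norm θ ^ α * Gtilde d α))

section Norms

variable {d : ℕ}

lemma l2norm_nonneg (u : Fin d → ℝ) : 0 ≤ l2norm u := Real.sqrt_nonneg _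

lemma norm_le_l2norm (u : Fin d → ℝ) : ‖u‖ ≤ l2norm u := by
  refine (pi_norm_le_iff_of_nonneg (l2norm_nonneg u)).2 fun i => ?_
  rw [Real.norm_eq_abs, l2norm]
  exact Real.abs_le_sqrt (Finset.single_le_sum (f := fun i => u i ^ 2)
    (fun j _ => sq_nonneg (u j)) (Finset.mem_univ i))

lemma l2norm_le_mul_norm (u : Fin d → ℝ) : l2norm u ≤ d * ‖u‖ := by
  refine Real.sqrt_le_iff.2 ⟨by positivity, ?_⟩
  have h : ∑ i, u i ^ 2 ≤ ∑ _i : Fin d, ‖u‖ ^ 2 := Finset.sum_le_sum fun i _ => by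
    rw [← sq_abs]
    exact pow_le_pow_left₀ (abs_nonneg _) (norm_le_pi_norm u i) 2
  refine h.trans ?_
  simp only [Finset.sum_const, Finset.card_univ, Fintype.card_fin, nsmul_eq_mul, mul_pow]
  refine mul_le_mul_of_nonneg_right ?_ (by positivity)
  exact_mod_cast Nat.le_self_pow two_ne_zero d

lemma l2norm_smul (c : ℝ) (u : Fin d → ℝ) : l2norm (c • u) = |c| * l2norm u := by
  simp only [l2norm, Pi.smul_apply, smul_eq_mul, mul_pow, ← Finset.mul_sum]
  rw [Real.sqrt_mul (sq_nonneg c), Real.sqrt_sq_eq_abs]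

@[fun_prop]
lemma continuous_l2norm : Continuous (l2norm : (Fin d → ℝ) → ℝ) := by
  unfold l2norm
  fun_prop

lemma l2norm_eq_norm_toLp (u : Fin d → ℝ) : l2norm u = ‖WithLp.toLp 2 u‖ := by
  simp [l2norm, EuclideanSpace.norm_eq]

lemma l2norm_pos {u : Fin d → ℝ} (hu : u ≠ 0) : 0 < l2norm u :=
  (norm_pos_iff.2 hu).trans_le (norm_le_l2norm u)

lemma abs_sum_mul_le (θ z : Fin d → ℝ) : |∑ i, θ i * z i| ≤ d * ‖θ‖ * ‖z‖ := by
  refine (Finset.abs_sum_le_sum_abs _ _).trans ?_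
  have h : ∑ i, |θ i * z i| ≤ ∑ _i : Fin d, ‖θ‖ * ‖z‖ := Finset.sum_le_sum fun i _ => by
    rw [abs_mul]
    exact mul_le_mul (norm_le_pi_norm θ i) (norm_le_pi_norm z i) (abs_nonneg _) (norm_nonneg _)
  refine h.trans (le_of_eq ?_)
  simp [mul_assoc]

end Norms

section Majorant

variable {d : ℕ}

/-- A radial function dominating the Lévy integrands `(1 - cos (θ·z)) / ‖z‖₂ ^ b`. -/
noncomputable def levyMajorant (b : ℝ) (z : Fin d → ℝ) : ℝ := min 1 (‖z‖ ^ 2) * ‖z‖ ^ (-b)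

/-- The integrand `(1 - cos (θ·z)) / ‖z‖₂ ^ b`. -/
noncomputable def levyIntegrand (b : ℝ) (θ z : Fin d → ℝ) : ℝ :=
  (1 - Real.cos (∑ i, θ i * z i)) / l2norm z ^ b

lemma levyMajorant_nonneg (b : ℝ) (z : Fin d → ℝ) : 0 ≤ levyMajorant b z := by
  unfold levyMajorant
  positivity

lemma integrable_levyMajorant [NeZero d] {α : ℝ} (hα0 : 0 < α) (hα2 : α < 2) :
    Integrable (levyMajorant (d := d) (d + α)) := by
  have hd : 1 ≤ d := NeZero.one_le
  have hd' : (1 : ℝ) ≤ d := by exact_mod_cast hd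
  have key := integrable_fun_norm_addHaar (E := Fin d → ℝ) volume
    (f := fun r : ℝ => min 1 (r ^ 2) * r ^ (-((d : ℝ) + α)))
  refine key.2 ?_
  simp only [Module.finrank_fintype_fun_eq_card, Fintype.card_fin, smul_eq_mul]
  rw [← Set.Ioc_union_Ioi_eq_Ioi zero_le_one]
  refine IntegrableOn.union ?_ ?_
  · have h1 : IntegrableOn (fun r : ℝ => r ^ (1 - α)) (Set.Ioc 0 1) :=
      (intervalIntegrable_iff_integrableOn_Ioc_of_le zero_le_one).1
        (intervalIntegral.intervalIntegrable_rpow' (by linarith))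
    refine h1.congr_fun (fun r hr => ?_) measurableSet_Ioc
    have hr0 : 0 < r := hr.1
    have : min 1 (r ^ 2) = r ^ 2 := min_eq_right (by nlinarith [hr.2])
    simp only [this]
    rw [← Real.rpow_natCast r (d - 1), ← Real.rpow_natCast r 2, ← Real.rpow_add hr0,
      ← Real.rpow_add hr0]
    congr 1
    push_cast [Nat.cast_sub hd]
    ring
  · have h1 : IntegrableOn (fun r : ℝ => r ^ (-1 - α)) (Set.Ioi 1) :=
      integrableOn_Ioi_rpow_of_lt (by linarith) one_pos
    refine h1.congr_fun (fun r hr => ?_) measurableSet_Ioi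
    have hr1 : 1 < r := hr
    have hr0 : 0 < r := one_pos.trans hr1
    have : min 1 (r ^ 2) = 1 := min_eq_left (by nlinarith)
    simp only [this, one_mul]
    rw [← Real.rpow_natCast r (d - 1), ← Real.rpow_add hr0]
    congr 1
    push_cast [Nat.cast_sub hd]
    ring

lemma levyIntegrand_nonneg (b : ℝ) (θ z : Fin d → ℝ) : 0 ≤ levyIntegrand b θ z :=
  div_nonneg (sub_nonneg.2 (Real.cos_le_one _)) (Real.rpow_nonneg (l2norm_nonneg z) b)

@[simp]
lemma levyIntegrand_apply_zero (b : ℝ) (θ : Fin d → ℝ) : levyIntegrand b θ 0 = 0 := by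
  simp [levyIntegrand]

lemma levyIntegrand_le {b : ℝ} (hb : 0 ≤ b) (θ z : Fin d → ℝ) :
    levyIntegrand b θ z ≤ (2 + (d * ‖θ‖) ^ 2) * levyMajorant b z := by
  rcases eq_or_ne z 0 with rfl | hz
  · simpa using mul_nonneg (by positivity) (levyMajorant_nonneg b _)
  have hz0 : 0 < ‖z‖ := norm_pos_iff.2 hz
  set x := ∑ i, θ i * z i
  have hx : x ^ 2 ≤ (d * ‖θ‖) ^ 2 * ‖z‖ ^ 2 := by
    rw [← sq_abs, ← mul_pow]
    exact pow_le_pow_left₀ (abs_nonneg _) (abs_sum_mul_le θ z) 2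
  have hcos : 1 - Real.cos x ≤ (2 + (d * ‖θ‖) ^ 2) * min 1 (‖z‖ ^ 2) := by
    have h1 := Real.neg_one_le_cos x
    have h2 := Real.one_sub_sq_div_two_le_cos (x := x)
    have h3 := sq_nonneg ((d : ℝ) * ‖θ‖)
    rcases le_total 1 (‖z‖ ^ 2) with h | h
    · rw [min_eq_left h]
      linarith
    · rw [min_eq_right h]
      nlinarith [sq_nonneg ‖z‖]
  rw [levyIntegrand, levyMajorant, ← mul_assoc, div_eq_mul_inv,
    ← Real.rpow_neg (l2norm_nonneg z)]
  refine mul_le_mul hcos ?_ (Real.rpow_nonneg (l2norm_nonneg z) _) (by positivity)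
  exact Real.rpow_le_rpow_of_nonpos hz0 (norm_le_l2norm z) (by linarith)

lemma levyMajorant_le_of_comparable {b : ℝ} (hb : 0 ≤ b) {q z : Fin d → ℝ}
    (h1 : ‖z‖ ≤ 2 * ‖q‖) (h2 : ‖q‖ ≤ 2 * ‖z‖) :
    levyMajorant b q ≤ 4 * 2 ^ b * levyMajorant b z := by
  rcases eq_or_ne z 0 with rfl | hz
  · have : q = 0 := by simpa using h2
    subst this
    have h := levyMajorant_nonneg b (0 : Fin d → ℝ)
    have h3 : (1 : ℝ) ≤ 2 ^ b := Real.one_le_rpow one_le_two hb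
    nlinarith
  have hz0 : 0 < ‖z‖ := norm_pos_iff.2 hz
  have hmin : min 1 (‖q‖ ^ 2) ≤ 4 * min 1 (‖z‖ ^ 2) := by
    have : ‖q‖ ^ 2 ≤ 4 * ‖z‖ ^ 2 := by nlinarith [norm_nonneg q]
    rcases le_total 1 (‖z‖ ^ 2) with h | h
    · rw [min_eq_left h]
      exact (min_le_left _ _).trans (by norm_num)
    · rw [min_eq_right h]
      exact (min_le_right _ _).trans this
  have hpow : ‖q‖ ^ (-b) ≤ 2 ^ b * ‖z‖ ^ (-b) := by
    calc ‖q‖ ^ (-b) ≤ (‖z‖ / 2) ^ (-b) :=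
          Real.rpow_le_rpow_of_nonpos (by positivity) (by linarith) (by linarith)
      _ = 2 ^ b * ‖z‖ ^ (-b) := by
          rw [Real.div_rpow hz0.le zero_le_two, Real.rpow_neg zero_le_two, div_inv_eq_mul, mul_comm]
  calc levyMajorant b q ≤ (4 * min 1 (‖z‖ ^ 2)) * (2 ^ b * ‖z‖ ^ (-b)) :=
        mul_le_mul hmin hpow (by positivity) (by positivity)
    _ = 4 * 2 ^ b * levyMajorant b z := by rw [levyMajorant]; ring

lemma measurable_levyIntegrand (b : ℝ) (θ : Fin d → ℝ) :
    Measurable (levyIntegrand b θ) := by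
  unfold levyIntegrand
  have : Measurable (l2norm : (Fin d → ℝ) → ℝ) := continuous_l2norm.measurable
  fun_prop

lemma continuousAt_levyIntegrand (b : ℝ) (θ : Fin d → ℝ) {z : Fin d → ℝ} (hz : z ≠ 0) :
    ContinuousAt (levyIntegrand b θ) z := by
  have h := l2norm_pos hz
  have hnum : Continuous fun z : Fin d → ℝ => 1 - Real.cos (∑ i, θ i * z i) := by fun_prop
  refine hnum.continuousAt.div ?_ (Real.rpow_pos_of_pos h b).ne'
  exact continuous_l2norm.continuousAt.rpow_const (Or.inl h.ne')

end Majorant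

section Rounding

variable {d : ℕ}

/-- Coordinatewise rounding to the nearest lattice point. -/
noncomputable def latticeRound (w : Fin d → ℝ) : Fin d → ℤ := fun i => round (w i)

/-- The inclusion of `ℤ^d` in `ℝ^d`. -/
def latticeCast (y : Fin d → ℤ) : Fin d → ℝ := fun i => (y i : ℝ)

@[simp]
lemma latticeCast_zero : latticeCast (0 : Fin d → ℤ) = 0 := by
  ext i
  simp [latticeCast]

lemma latticeCast_ne_zero {y : Fin d → ℤ} (hy : y ≠ 0) : latticeCast y ≠ 0 := by
  intro h
  refine hy (funext fun i => ?_)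
  have := congrFun h i
  simpa [latticeCast] using this

lemma one_le_norm_latticeCast {y : Fin d → ℤ} (hy : y ≠ 0) : 1 ≤ ‖latticeCast y‖ := by
  obtain ⟨i, hi⟩ := Function.ne_iff.1 hy
  refine le_trans ?_ (norm_le_pi_norm (latticeCast y) i)
  rw [latticeCast, Real.norm_eq_abs]
  exact_mod_cast Int.one_le_abs hi

lemma norm_sub_latticeRound_le (w : Fin d → ℝ) : ‖w - latticeCast (latticeRound w)‖ ≤ 1 / 2 :=
  (pi_norm_le_iff_of_nonneg (by norm_num)).2 fun i => abs_sub_round (w i)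

@[fun_prop]
lemma measurable_latticeRound : Measurable (latticeRound : (Fin d → ℝ) → Fin d → ℤ) := by
  refine measurable_pi_lambda _ fun i => ?_
  simp only [latticeRound, round_eq]
  fun_prop

lemma map_latticeRound_volume :
    (volume : Measure (Fin d → ℝ)).map latticeRound = Measure.count := by
  refine Measure.ext_of_singleton fun y => ?_
  rw [Measure.map_apply measurable_latticeRound (measurableSet_singleton y),
    Measure.count_singleton]
  have : (latticeRound : (Fin d → ℝ) → Fin d → ℤ) ⁻¹' {y} =
      Set.univ.pi fun i => Set.Ico ((y i : ℝ) - 1 / 2) ((y i : ℝ) + 1 / 2) := by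
    ext w
    simp only [Set.mem_preimage, Set.mem_singleton_iff, Set.mem_pi, Set.mem_univ, true_implies,
      Set.mem_Ico, latticeRound, funext_iff, round_eq, Int.floor_eq_iff]
    refine forall_congr' fun i => ⟨fun h => ⟨?_, ?_⟩, fun h => ⟨?_, ?_⟩⟩ <;>
      linarith [h.1, h.2]
  rw [this, Real.volume_pi_Ico]
  refine Finset.prod_eq_one fun i _ => ?_
  norm_num

lemma integrable_comp_latticeRound_iff {F : (Fin d → ℤ) → ℝ} :
    Integrable (fun w => F (latticeRound w)) ↔ Summable F := by
  rw [← summable_norm_iff, ← integrable_count_iff, ← map_latticeRound_volume,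
    integrable_map_measure (measurable_of_countable F).aestronglyMeasurable
      measurable_latticeRound.aemeasurable]
  rfl

lemma integral_comp_latticeRound {F : (Fin d → ℤ) → ℝ} (hF : Summable F) :
    ∫ w, F (latticeRound w) = ∑' y, F y := by
  have hi : Integrable F Measure.count := integrable_count_iff.2 hF.norm
  rw [← integral_map (φ := latticeRound) measurable_latticeRound.aemeasurable
    (measurable_of_countable F).aestronglyMeasurable, map_latticeRound_volume,
    integral_countable hi]
  simp [Measure.real]

lemma norm_comparable_latticeRound {w : Fin d → ℝ} (hw : latticeRound w ≠ 0) :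
    ‖w‖ ≤ 2 * ‖latticeCast (latticeRound w)‖ ∧ ‖latticeCast (latticeRound w)‖ ≤ 2 * ‖w‖ := by
  have h1 := one_le_norm_latticeCast hw
  have h2 := norm_sub_latticeRound_le w
  have h3 := norm_sub_norm_le w (latticeCast (latticeRound w))
  have h4 := norm_sub_norm_le (latticeCast (latticeRound w)) w
  rw [norm_sub_rev] at h4
  constructor <;> linarith

/-- The point of the lattice `ε ℤ^d` nearest to `z`. -/
noncomputable def scaledRound (ε : ℝ) (z : Fin d → ℝ) : Fin d → ℝ :=
  ε • latticeCast (latticeRound (ε⁻¹ • z))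

lemma levyMajorant_scaledRound_le {b : ℝ} (hb : 0 ≤ b) {ε : ℝ} (hε : 0 < ε) (z : Fin d → ℝ) :
    levyMajorant b (scaledRound ε z) ≤ 4 * 2 ^ b * levyMajorant b z := by
  by_cases hz : latticeRound (ε⁻¹ • z) = 0
  · have h0 : scaledRound ε z = 0 := by simp [scaledRound, hz]
    rw [h0]
    have h := levyMajorant_nonneg b z
    have h1 : levyMajorant b (0 : Fin d → ℝ) = 0 := by simp [levyMajorant]
    rw [h1]
    positivity
  obtain ⟨h1, h2⟩ := norm_comparable_latticeRound hz
  rw [norm_smul, Real.norm_of_nonneg (inv_pos.2 hε).le, inv_mul_eq_div] at h1 h2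
  rw [div_le_iff₀ hε] at h1
  rw [← mul_div_assoc, le_div_iff₀ hε] at h2
  refine levyMajorant_le_of_comparable hb ?_ ?_ <;>
  · rw [scaledRound, norm_smul, Real.norm_of_nonneg hε.le]
    linarith

lemma tendsto_scaledRound (z : Fin d → ℝ) :
    Tendsto (fun ε => scaledRound ε z) (𝓝[>] 0) (𝓝 z) := by
  rw [tendsto_iff_norm_sub_tendsto_zero]
  have h0 : Tendsto (fun ε : ℝ => ε * (1 / 2)) (𝓝[>] 0) (𝓝 0) := by
    have : Tendsto (fun ε : ℝ => ε * (1 / 2)) (𝓝 0) (𝓝 (0 * (1 / 2))) :=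
      tendsto_id.mul_const _
    rw [zero_mul] at this
    exact this.mono_left nhdsWithin_le_nhds
  refine squeeze_zero' (Eventually.of_forall fun _ => norm_nonneg _) ?_ h0
  filter_upwards [self_mem_nhdsWithin] with ε hε
  have hε : 0 < ε := hε
  have : scaledRound ε z - z =
      -(ε • (ε⁻¹ • z - latticeCast (latticeRound (ε⁻¹ • z)))) := by
    rw [smul_sub, smul_inv_smul₀ hε.ne', scaledRound, neg_sub]
  rw [this, norm_neg, norm_smul, Real.norm_of_nonneg hε.le]
  exact mul_le_mul_of_nonneg_left (norm_sub_latticeRound_le _) hε.le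

lemma measurable_scaledRound (ε : ℝ) :
    Measurable (scaledRound ε : (Fin d → ℝ) → Fin d → ℝ) := by
  have : Measurable (latticeCast : (Fin d → ℤ) → Fin d → ℝ) := measurable_of_countable _
  unfold scaledRound
  fun_prop

end Rounding

section Symbol

variable {d : ℕ}

lemma latticeSymbol_eq_neg_tsum {α : ℝ} (θ : Fin d → ℝ) :
    latticeSymbol d α θ = -∑' y, levyIntegrand (d + α) θ (latticeCast y) := by
  have h : ∀ y : Fin d → ℤ,
      (Real.cos (∑ i, θ i * (y i : ℝ)) - 1) / zl2 y ^ ((d : ℝ) + α) =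
        -levyIntegrand (d + α) θ (latticeCast y) := fun y => by
    rw [levyIntegrand, ← neg_div, neg_sub]
    rfl
  simp only [latticeSymbol, h]
  rw [← tsum_neg]
  refine tsum_subtype_eq_of_support_subset (s := {y : Fin d → ℤ | y ≠ 0})
    (f := fun y => -levyIntegrand (d + α) θ (latticeCast y)) fun y hy h0 => hy ?_
  simp [h0]

lemma integrable_levyMajorant_scaledRound [NeZero d] {α : ℝ} (hα0 : 0 < α) (hα2 : α < 2)
    {ε : ℝ} (hε : 0 < ε) :
    Integrable fun z : Fin d → ℝ => levyMajorant (d + α) (scaledRound ε z) := by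
  refine ((integrable_levyMajorant (d := d) hα0 hα2).const_mul (4 * 2 ^ ((d : ℝ) + α))).mono' ?_ ?_
  · have : Measurable (levyMajorant (d := d) (d + α)) := by
      unfold levyMajorant
      fun_prop
    exact (this.comp (measurable_scaledRound ε)).aestronglyMeasurable
  · refine Eventually.of_forall fun z => ?_
    rw [Real.norm_of_nonneg (levyMajorant_nonneg _ _)]
    exact levyMajorant_scaledRound_le (by positivity) hε z

lemma summable_levyMajorant_latticeCast [NeZero d] {α : ℝ} (hα0 : 0 < α) (hα2 : α < 2) :
    Summable fun y : Fin d → ℤ => levyMajorant (d + α) (latticeCast y) := by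
  rw [← integrable_comp_latticeRound_iff]
  simpa [scaledRound] using integrable_levyMajorant_scaledRound (d := d) hα0 hα2 one_pos

lemma summable_levyIntegrand_latticeCast [NeZero d] {α : ℝ} (hα0 : 0 < α) (hα2 : α < 2)
    (θ : Fin d → ℝ) :
    Summable fun y : Fin d → ℤ => levyIntegrand (d + α) θ (latticeCast y) :=
  Summable.of_nonneg_of_le (fun _ => levyIntegrand_nonneg _ _ _)
    (fun _ => levyIntegrand_le (by positivity) _ _)
    ((summable_levyMajorant_latticeCast hα0 hα2).mul_left _)

lemma continuous_latticeSymbol [NeZero d] {α : ℝ} (hα0 : 0 < α) (hα2 : α < 2) :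
    Continuous (latticeSymbol d α) := by
  simp only [funext fun θ => latticeSymbol_eq_neg_tsum (d := d) (α := α) θ]
  refine Continuous.neg (continuous_tsum (fun y => ?_)
    ((summable_levyMajorant_latticeCast (d := d) hα0 hα2).mul_left 2) fun y θ => ?_)
  · unfold levyIntegrand
    fun_prop
  · rw [Real.norm_of_nonneg (levyIntegrand_nonneg _ _ _)]
    rcases eq_or_ne y 0 with rfl | hy
    · simp [levyMajorant]
    · have h1 := one_le_norm_latticeCast hy
      have hmin : min 1 (‖latticeCast y‖ ^ 2) = 1 := min_eq_left (one_le_pow₀ h1)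
      rw [levyIntegrand, levyMajorant, hmin, one_mul, div_eq_mul_inv,
        ← Real.rpow_neg (l2norm_nonneg _)]
      refine mul_le_mul ?_ ?_ (Real.rpow_nonneg (l2norm_nonneg _) _) zero_le_two
      · linarith [Real.neg_one_le_cos (∑ i, θ i * latticeCast y i)]
      · exact Real.rpow_le_rpow_of_nonpos (by linarith) (norm_le_l2norm _)
          (by linarith [(Nat.cast_nonneg d : (0 : ℝ) ≤ d)])

lemma latticeSymbol_nonpos {α : ℝ} (θ : Fin d → ℝ) : latticeSymbol d α θ ≤ 0 := by
  rw [latticeSymbol_eq_neg_tsum, neg_nonpos]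
  exact tsum_nonneg fun _ => levyIntegrand_nonneg _ _ _

lemma sum_levyIntegrand_le [NeZero d] {α : ℝ} (hα0 : 0 < α) (hα2 : α < 2)
    (θ : Fin d → ℝ) (S : Finset (Fin d → ℤ)) :
    ∑ y ∈ S, levyIntegrand (d + α) θ (latticeCast y) ≤ -latticeSymbol d α θ := by
  rw [latticeSymbol_eq_neg_tsum, neg_neg]
  exact (summable_levyIntegrand_latticeCast hα0 hα2 θ).sum_le_tsum S
    fun _ _ => levyIntegrand_nonneg _ _ _

lemma levyIntegrand_smul_right {b ε : ℝ} (hε : 0 < ε) (θ z : Fin d → ℝ) :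
    levyIntegrand b θ (ε • z) = ε ^ (-b) * levyIntegrand b (ε • θ) z := by
  have h : ∑ i, θ i * (ε • z) i = ∑ i, (ε • θ) i * z i :=
    Finset.sum_congr rfl fun i _ => by
      simp only [Pi.smul_apply, smul_eq_mul]
      ring
  rw [levyIntegrand, levyIntegrand, h, l2norm_smul, abs_of_pos hε,
    Real.mul_rpow hε.le (l2norm_nonneg z), Real.rpow_neg hε.le]
  have := (Real.rpow_pos_of_pos hε b).ne'
  field_simp

lemma integral_levyIntegrand_scaledRound [NeZero d] {α : ℝ} (hα0 : 0 < α) (hα2 : α < 2)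
    {ε : ℝ} (hε : 0 < ε) (θ : Fin d → ℝ) :
    ∫ z, levyIntegrand (d + α) θ (scaledRound ε z) =
      ε ^ (-α) * -latticeSymbol d α (ε • θ) := by
  have h1 := Measure.integral_comp_inv_smul (volume : Measure (Fin d → ℝ))
    (fun w => levyIntegrand (d + α) θ (ε • latticeCast (latticeRound w))) ε
  simp only [scaledRound]
  rw [h1]
  simp only [levyIntegrand_smul_right hε, Module.finrank_fintype_fun_eq_card, Fintype.card_fin,
    smul_eq_mul]
  rw [integral_const_mul, integral_comp_latticeRound
    (summable_levyIntegrand_latticeCast hα0 hα2 (ε • θ)), latticeSymbol_eq_neg_tsum, neg_neg,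
    abs_of_pos (pow_pos hε d), ← mul_assoc, ← Real.rpow_natCast, ← Real.rpow_add hε]
  congr 2
  ring

lemma tendsto_rpow_neg_mul_latticeSymbol [NeZero d] {α : ℝ} (hα0 : 0 < α) (hα2 : α < 2)
    (θ : Fin d → ℝ) :
    Tendsto (fun ε : ℝ => ε ^ (-α) * -latticeSymbol d α (ε • θ)) (𝓝[>] 0)
      (𝓝 (∫ z, levyIntegrand (d + α) θ z)) := by
  have hlim : Tendsto (fun ε : ℝ => ∫ z, levyIntegrand (d + α) θ (scaledRound ε z)) (𝓝[>] 0)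
      (𝓝 (∫ z, levyIntegrand (d + α) θ z)) := by
    refine tendsto_integral_filter_of_dominated_convergence
      (fun z => (2 + (d * ‖θ‖) ^ 2) * (4 * 2 ^ ((d : ℝ) + α) * levyMajorant (d + α) z)) ?_ ?_ ?_ ?_
    · exact Eventually.of_forall fun ε =>
        ((measurable_levyIntegrand _ θ).comp (measurable_scaledRound ε)).aestronglyMeasurable
    · filter_upwards [self_mem_nhdsWithin] with ε hε
      refine Eventually.of_forall fun z => ?_
      rw [Real.norm_of_nonneg (levyIntegrand_nonneg _ _ _)]
      exact (levyIntegrand_le (by positivity) _ _).trans (mul_le_mul_of_nonneg_left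
        (levyMajorant_scaledRound_le (by positivity) hε z) (by positivity))
    · exact ((integrable_levyMajorant hα0 hα2).const_mul _).const_mul _
    · have h0 : ∀ᵐ z : Fin d → ℝ, z ≠ 0 := by
        simp [ae_iff]
      filter_upwards [h0] with z hz
      exact (continuousAt_levyIntegrand _ θ hz).tendsto.comp (tendsto_scaledRound z)
  refine hlim.congr' ?_
  filter_upwards [self_mem_nhdsWithin] with ε hε
  exact integral_levyIntegrand_scaledRound hα0 hα2 hε θ

end Symbol

section Rotation

variable {d : ℕ}

lemma integral_levyIntegrand_eq_of_l2norm_eq (b : ℝ) {θ η : Fin d → ℝ}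
    (h : l2norm θ = l2norm η) : ∫ z, levyIntegrand b θ z = ∫ z, levyIntegrand b η z := by
  have hE : ∀ ξ : Fin d → ℝ, ∫ z, levyIntegrand b ξ z =
      ∫ w : EuclideanSpace ℝ (Fin d),
        (1 - Real.cos (inner ℝ (WithLp.toLp 2 ξ) w)) / ‖w‖ ^ b := fun ξ => by
    rw [← (EuclideanSpace.volume_preserving_symm_measurableEquiv_toLp (Fin d)).integral_comp'
      (levyIntegrand b ξ)]
    refine integral_congr_ae (Eventually.of_forall fun w => ?_)
    simp only [levyIntegrand, l2norm_eq_norm_toLp]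
    simp [PiLp.inner_apply, mul_comm]
  rw [l2norm_eq_norm_toLp, l2norm_eq_norm_toLp] at h
  have hR := Submodule.reflection_sub h
  set R := (Submodule.span ℝ {WithLp.toLp 2 θ - WithLp.toLp 2 η})ᗮ.reflection
  rw [hE, hE, ← R.measurePreserving.integral_comp R.toHomeomorph.measurableEmbedding
    (fun w => (1 - Real.cos (inner ℝ (WithLp.toLp 2 η) w)) / ‖w‖ ^ b)]
  refine integral_congr_ae (Eventually.of_forall fun w => ?_)
  simp only [← hR, R.inner_map_map, R.norm_map]

lemma integral_levyIntegrand [NeZero d] {α : ℝ} (hα0 : 0 < α) (θ : Fin d → ℝ) :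
    ∫ z, levyIntegrand (d + α) θ z = l2norm θ ^ α * Gtilde d α := by
  rcases eq_or_ne θ 0 with rfl | hθ
  · simp [levyIntegrand, l2norm, Real.zero_rpow hα0.ne']
  have hρ := l2norm_pos hθ
  set ρ := l2norm θ with hρ_def
  set e : Fin d → ℝ := Pi.single 0 1 with he
  have hG : Gtilde d α = ∫ z, levyIntegrand (d + α) e z := by
    refine integral_congr_ae (Eventually.of_forall fun z => ?_)
    have hd : 0 < d := NeZero.pos d
    simp only [levyIntegrand, hd, dite_true, he, Pi.single_apply, ite_mul, one_mul, zero_mul,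
      Finset.sum_ite_eq', Finset.mem_univ, if_true]
    rfl
  have he1 : l2norm e = 1 := by
    simp [l2norm, he, Pi.single_apply, ite_pow]
  have hn : l2norm θ = l2norm (ρ • e) := by
    rw [l2norm_smul, he1, abs_of_pos hρ, mul_one]
  have hs : ∀ z, levyIntegrand (d + α) (ρ • e) z =
      ρ ^ ((d : ℝ) + α) * levyIntegrand (d + α) e (ρ • z) := fun z => by
    rw [levyIntegrand_smul_right hρ, ← mul_assoc, ← Real.rpow_add hρ]
    simp
  rw [integral_levyIntegrand_eq_of_l2norm_eq _ hn]
  simp only [hs]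
  rw [integral_const_mul, Measure.integral_comp_smul, ← hG, Module.finrank_fintype_fun_eq_card,
    Fintype.card_fin, abs_of_pos (by positivity), smul_eq_mul, ← mul_assoc, Real.rpow_add hρ,
    Real.rpow_natCast]
  have := (pow_pos hρ d).ne'
  field_simp

end Rotation

section LowerBound

variable {d : ℕ}

lemma exists_norm_le_abs_apply [NeZero d] (θ : Fin d → ℝ) : ∃ i, ‖θ‖ ≤ |θ i| := by
  by_contra! h
  have h0 : 0 < ‖θ‖ := (abs_nonneg _).trans_lt (h 0)
  exact lt_irrefl _ ((pi_norm_lt_iff h0).2 h)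

lemma le_levyIntegrand {b m L : ℝ} (hb : 0 ≤ b) (hm : 0 ≤ m) {θ z : Fin d → ℝ} (hz : z ≠ 0)
    (h1 : m ≤ |∑ i, θ i * z i|) (h2 : |∑ i, θ i * z i| ≤ Real.pi) (hL : l2norm z ≤ L) :
    2 / Real.pi ^ 2 * m ^ 2 / L ^ b ≤ levyIntegrand b θ z := by
  have hz0 := l2norm_pos hz
  have hcos := Real.cos_le_one_sub_mul_cos_sq h2
  have hsq : m ^ 2 ≤ (∑ i, θ i * z i) ^ 2 := by
    rw [← sq_abs (∑ i, θ i * z i)]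
    exact pow_le_pow_left₀ hm h1 2
  have : 2 / Real.pi ^ 2 * m ^ 2 ≤ 2 / Real.pi ^ 2 * (∑ i, θ i * z i) ^ 2 :=
    mul_le_mul_of_nonneg_left hsq (by positivity)
  exact div_le_div₀ (by linarith [Real.cos_le_one (∑ i, θ i * z i)]) (by linarith)
    (Real.rpow_pos_of_pos hz0 b) (Real.rpow_le_rpow hz0.le hL hb)

/-- The lattice points with `M ≤ |y j| < 2 * M` lying in the orthant of `θ`. -/
noncomputable def orthantBox (θ : Fin d → ℝ) (M : ℕ) : Finset (Fin d → ℤ) :=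
  Fintype.piFinset fun j =>
    (Finset.Ico M (2 * M)).image fun k : ℕ => (if 0 ≤ θ j then 1 else -1) * (k : ℤ)

lemma card_orthantBox (θ : Fin d → ℝ) (M : ℕ) : (orthantBox θ M).card = M ^ d := by
  have h : ∀ j, ((Finset.Ico M (2 * M)).image fun k : ℕ =>
      (if 0 ≤ θ j then 1 else -1) * (k : ℤ)).card = M := fun j => by
    rw [Finset.card_image_of_injective _ fun k l hkl => ?_, Nat.card_Ico]
    · omega
    · split_ifs at hkl <;> omega
  rw [orthantBox, Fintype.card_piFinset]
  simp only [h, Finset.prod_const, Finset.card_univ, Fintype.card_fin]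

lemma mul_apply_of_mem_orthantBox {θ : Fin d → ℝ} {M : ℕ} {y : Fin d → ℤ}
    (hy : y ∈ orthantBox θ M) (j : Fin d) :
    (M : ℝ) ≤ |latticeCast y j| ∧ |latticeCast y j| ≤ 2 * M ∧
      θ j * latticeCast y j = |θ j| * |latticeCast y j| := by
  obtain ⟨k, hk, hkj⟩ := Finset.mem_image.1 (Fintype.mem_piFinset.1 hy j)
  obtain ⟨hk1, hk2⟩ := Finset.mem_Ico.1 hk
  have hk1' : (M : ℝ) ≤ k := by exact_mod_cast hk1
  have hk2' : (k : ℝ) ≤ 2 * M := by exact_mod_cast hk2.le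
  have hk0 : (0 : ℝ) ≤ k := Nat.cast_nonneg k
  by_cases hθ : 0 ≤ θ j
  · have : latticeCast y j = k := by
      simp [latticeCast, ← hkj, hθ]
    rw [this, abs_of_nonneg hk0, abs_of_nonneg hθ]
    exact ⟨hk1', hk2', rfl⟩
  · have : latticeCast y j = -k := by
      simp [latticeCast, ← hkj, hθ]
    rw [this, abs_neg, abs_of_nonneg hk0, abs_of_neg (not_le.1 hθ)]
    exact ⟨hk1', hk2', by ring⟩

lemma exists_mul_norm_rpow_le_neg_latticeSymbol_of_small [NeZero d] (hd3 : d ≤ 3) {α : ℝ}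
    (hα0 : 0 < α) (hα2 : α < 2) :
    ∃ c : ℝ, 0 < c ∧ ∀ θ : Fin d → ℝ, 0 < ‖θ‖ → ‖θ‖ ≤ 1 / 2 →
      c * ‖θ‖ ^ α ≤ -latticeSymbol d α θ := by
  have hd0 : 0 < (d : ℝ) := by exact_mod_cast NeZero.pos d
  have hd3' : (d : ℝ) ≤ 3 := by exact_mod_cast hd3
  refine ⟨2 / Real.pi ^ 2 * (1 / 4) ^ 2 / (2 * d) ^ ((d : ℝ) + α), by positivity,
    fun θ ha ha2 => ?_⟩
  set a := ‖θ‖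
  set M := ⌊1 / (2 * a)⌋₊
  have hM1 : 1 ≤ M := Nat.le_floor (by
    rw [Nat.cast_one, le_div_iff₀ (by positivity)]
    linarith)
  have hM1' : (1 : ℝ) ≤ M := by exact_mod_cast hM1
  have hMle : (M : ℝ) * (2 * a) ≤ 1 :=
    (le_div_iff₀ (by positivity)).1 (Nat.floor_le (by positivity))
  have hMlt : 1 < (M + 1 : ℝ) * (2 * a) :=
    (div_lt_iff₀ (by positivity)).1 (Nat.lt_floor_add_one (1 / (2 * a)))
  have hM4 : 1 / 4 ≤ a * M := by nlinarith
  obtain ⟨i, hi⟩ := exists_norm_le_abs_apply θ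
  have hterm : ∀ y ∈ orthantBox θ M,
      2 / Real.pi ^ 2 * (1 / 4) ^ 2 / (d * (2 * M)) ^ ((d : ℝ) + α) ≤
        levyIntegrand (d + α) θ (latticeCast y) := fun y hy => by
    have hyn : ‖latticeCast y‖ ≤ 2 * M :=
      (pi_norm_le_iff_of_nonneg (by positivity)).2 fun j =>
        (mul_apply_of_mem_orthantBox hy j).2.1
    have hsum : ∑ j, θ j * latticeCast y j = ∑ j, |θ j| * |latticeCast y j| :=
      Finset.sum_congr rfl fun j _ => (mul_apply_of_mem_orthantBox hy j).2.2
    refine le_levyIntegrand (by positivity) (by norm_num) ?_ ?_ ?_ ?_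
    · intro h0
      have := (mul_apply_of_mem_orthantBox hy i).1
      rw [h0, Pi.zero_apply, abs_zero] at this
      linarith
    · rw [hsum, abs_of_nonneg (Finset.sum_nonneg fun j _ => by positivity)]
      refine le_trans (hM4.trans ?_) (Finset.single_le_sum
        (f := fun j => |θ j| * |latticeCast y j|) (fun j _ => by positivity) (Finset.mem_univ i))
      exact mul_le_mul hi (mul_apply_of_mem_orthantBox hy i).1 (by positivity) (abs_nonneg _)
    · refine (abs_sum_mul_le θ (latticeCast y)).trans ?_
      have h1 : (d : ℝ) * a * ‖latticeCast y‖ ≤ d * a * (2 * M) :=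
        mul_le_mul_of_nonneg_left hyn (by positivity)
      have h2 : (d : ℝ) * (a * (2 * M)) ≤ d * 1 :=
        mul_le_mul_of_nonneg_left (by linarith) hd0.le
      linarith [Real.pi_gt_three]
    · exact (l2norm_le_mul_norm _).trans (mul_le_mul_of_nonneg_left hyn hd0.le)
  refine le_trans ?_ (sum_levyIntegrand_le hα0 hα2 θ (orthantBox θ M))
  refine le_trans ?_ (Finset.card_nsmul_le_sum _ _ _ hterm)
  have hM0 : (0 : ℝ) < M := by linarith
  have hpow : a ^ α ≤ (M : ℝ) ^ (-α) := by
    rw [Real.rpow_neg hM0.le, ← Real.inv_rpow hM0.le]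
    refine Real.rpow_le_rpow ha.le ?_ hα0.le
    rw [← one_div, le_div_iff₀ hM0]
    nlinarith
  have hsplit : ((M : ℝ) ^ d) * (2 / Real.pi ^ 2 * (1 / 4) ^ 2 / (d * (2 * M)) ^ ((d : ℝ) + α)) =
      2 / Real.pi ^ 2 * (1 / 4) ^ 2 / (2 * d) ^ ((d : ℝ) + α) * (M : ℝ) ^ (-α) := by
    rw [show (d : ℝ) * (2 * M) = 2 * d * M by ring, Real.mul_rpow (by positivity) hM0.le,
      Real.rpow_add hM0, Real.rpow_natCast, Real.rpow_neg hM0.le]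
    have := (pow_pos hM0 d).ne'
    have := (Real.rpow_pos_of_pos hM0 α).ne'
    have := (Real.rpow_pos_of_pos (show 0 < 2 * (d : ℝ) by positivity) (d + α)).ne'
    field_simp
  rw [card_orthantBox, nsmul_eq_mul, Nat.cast_pow, hsplit]
  exact mul_le_mul_of_nonneg_left hpow (by positivity)

lemma exists_mul_norm_rpow_le_neg_latticeSymbol [NeZero d] (hd3 : d ≤ 3) {α : ℝ}
    (hα0 : 0 < α) (hα2 : α < 2) :
    ∃ c : ℝ, 0 < c ∧ ∀ θ : Fin d → ℝ, ‖θ‖ ≤ Real.pi →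
      c * ‖θ‖ ^ α ≤ -latticeSymbol d α θ := by
  obtain ⟨c, hc, hsmall⟩ :=
    exists_mul_norm_rpow_le_neg_latticeSymbol_of_small (d := d) hd3 hα0 hα2
  have hd0 : 0 < (d : ℝ) := by exact_mod_cast NeZero.pos d
  set K := 2 / Real.pi ^ 2 * (1 / 2) ^ 2 / (d : ℝ) ^ ((d : ℝ) + α) with hK
  have hπ := Real.rpow_pos_of_pos Real.pi_pos α
  have hK0 : 0 < K := by positivity
  refine ⟨min c (K / Real.pi ^ α), lt_min hc (by positivity), fun θ hθ => ?_⟩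
  rcases (norm_nonneg θ).eq_or_lt with h0 | h0
  · rw [← h0, Real.zero_rpow hα0.ne', mul_zero, neg_nonneg]
    exact latticeSymbol_nonpos θ
  rcases le_total ‖θ‖ (1 / 2) with h | h
  · exact (mul_le_mul_of_nonneg_right (min_le_left _ _) (by positivity)).trans (hsmall θ h0 h)
  obtain ⟨i, hi⟩ := exists_norm_le_abs_apply θ
  have hcast : latticeCast (Pi.single i 1 : Fin d → ℤ) = Pi.single i 1 := by
    ext j
    by_cases hj : j = i <;> simp [latticeCast, hj]
  have hsum : ∑ j, θ j * latticeCast (Pi.single i 1 : Fin d → ℤ) j = θ i := by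
    simp [hcast, Pi.single_apply]
  have hterm : K ≤ levyIntegrand (d + α) θ (latticeCast (Pi.single i 1 : Fin d → ℤ)) := by
    refine le_levyIntegrand (by positivity) (by norm_num) ?_ ?_ ?_ ?_
    · exact latticeCast_ne_zero (by simp)
    · rw [hsum]
      linarith
    · rw [hsum]
      exact (norm_le_pi_norm θ i).trans hθ
    · refine (l2norm_le_mul_norm _).trans (le_of_eq ?_)
      rw [hcast, Pi.norm_single]
      simp
  have hS := sum_levyIntegrand_le hα0 hα2 θ {Pi.single i 1}
  rw [Finset.sum_singleton] at hS
  refine le_trans ?_ (hterm.trans hS)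
  calc min c (K / Real.pi ^ α) * ‖θ‖ ^ α ≤ K / Real.pi ^ α * Real.pi ^ α :=
        mul_le_mul (min_le_right _ _) (Real.rpow_le_rpow h0.le hθ hα0.le) (by positivity)
          (by positivity)
    _ = K := div_mul_cancel₀ K hπ.ne'

end LowerBound

section HeatKernelLimit

variable {d : ℕ}

lemma integrable_exp_neg_mul_norm_rpow [NeZero d] {α b : ℝ} (hα0 : 0 < α) (hb : 0 < b) :
    Integrable fun θ : Fin d → ℝ => Real.exp (-b * ‖θ‖ ^ α) := by
  refine (integrable_fun_norm_addHaar (E := Fin d → ℝ) volume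
    (f := fun r : ℝ => Real.exp (-b * r ^ α))).2 ?_
  simp only [Module.finrank_fintype_fun_eq_card, Fintype.card_fin, smul_eq_mul,
    ← Real.rpow_natCast]
  exact integrableOn_rpow_mul_exp_neg_mul_rpow
    (neg_one_lt_zero.trans_le (Nat.cast_nonneg _)) hα0 hb

lemma integral_exp_neg_mul_norm_rpow {α c r : ℝ} (hα0 : 0 < α) (hr : 0 < r) :
    ∫ θ : Fin d → ℝ, Real.exp (-(r * c) * ‖θ‖ ^ α) =
      r ^ (-((d : ℝ) / α)) * ∫ θ : Fin d → ℝ, Real.exp (-c * ‖θ‖ ^ α) := by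
  have hR : 0 < r ^ (1 / α) := Real.rpow_pos_of_pos hr _
  have h := Measure.integral_comp_smul (volume : Measure (Fin d → ℝ))
    (fun θ => Real.exp (-c * ‖θ‖ ^ α)) (r ^ (1 / α))
  have hpow : ((r ^ (1 / α)) ^ d)⁻¹ = r ^ (-((d : ℝ) / α)) := by
    rw [← Real.rpow_natCast, ← Real.rpow_mul hr.le, ← Real.rpow_neg hr.le]
    congr 1
    ring
  rw [Module.finrank_fintype_fun_eq_card, Fintype.card_fin, abs_of_pos (by positivity), hpow,
    smul_eq_mul] at h
  rw [← h]
  refine integral_congr_ae (Eventually.of_forall fun θ => ?_)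
  have : ‖r ^ (1 / α) • θ‖ ^ α = r * ‖θ‖ ^ α := by
    rw [norm_smul, Real.norm_of_nonneg hR.le, Real.mul_rpow hR.le (norm_nonneg θ),
      ← Real.rpow_mul hr.le, one_div_mul_cancel hα0.ne', Real.rpow_one]
  simp only [this]
  congr 1
  ring

/-- The torus `[-π, π]^d`. -/
def torusBox (d : ℕ) : Set (Fin d → ℝ) := Set.univ.pi fun _ => Set.Icc (-Real.pi) Real.pi

lemma measurableSet_torusBox : MeasurableSet (torusBox d) :=
  MeasurableSet.univ_pi fun _ => measurableSet_Icc

lemma mem_torusBox_iff {θ : Fin d → ℝ} : θ ∈ torusBox d ↔ ‖θ‖ ≤ Real.pi := by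
  rw [pi_norm_le_iff_of_nonneg Real.pi_pos.le]
  simp only [torusBox, Set.mem_pi, Set.mem_univ, true_implies, Set.mem_Icc, Real.norm_eq_abs,
    abs_le]

/-- The Fourier integrand of the rescaled return probability. -/
noncomputable def rescaledIntegrand (α N r : ℝ) (θ : Fin d → ℝ) : ℝ :=
  (torusBox d).indicator (fun θ => Real.exp (r * N * latticeSymbol d α θ))
    (N ^ (-(1 / α)) • θ)

lemma rpow_mul_pTrans_eq {α N : ℝ} (hN : 0 < N) (r : ℝ) :
    N ^ ((d : ℝ) / α) * pTrans d α (r * N) 0 =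
      ((2 * Real.pi) ^ d)⁻¹ * ∫ θ : Fin d → ℝ, rescaledIntegrand α N r θ := by
  have hε : 0 < N ^ (-(1 / α)) := Real.rpow_pos_of_pos hN _
  have hpow : ((N ^ (-(1 / α))) ^ d)⁻¹ = N ^ ((d : ℝ) / α) := by
    rw [← Real.rpow_natCast, ← Real.rpow_mul hN.le, ← Real.rpow_neg hN.le]
    congr 1
    ring
  have h := Measure.integral_comp_smul (volume : Measure (Fin d → ℝ))
    ((torusBox d).indicator (fun θ => Real.exp (r * N * latticeSymbol d α θ))) (N ^ (-(1 / α)))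
  rw [Module.finrank_fintype_fun_eq_card, Fintype.card_fin, abs_of_pos (by positivity), hpow,
    smul_eq_mul, integral_indicator measurableSet_torusBox] at h
  simp only [rescaledIntegrand, pTrans]
  rw [h]
  simp only [Pi.zero_apply, Int.cast_zero, zero_mul, Finset.sum_const_zero, Real.cos_zero,
    mul_one, torusBox]
  ring

lemma measurable_rescaledIntegrand [NeZero d] {α : ℝ} (hα0 : 0 < α) (hα2 : α < 2) (N r : ℝ) :
    Measurable (rescaledIntegrand (d := d) α N r) := by
  have h : Measurable (latticeSymbol d α) := (continuous_latticeSymbol hα0 hα2).measurable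
  have h1 : Measurable fun θ => Real.exp (r * N * latticeSymbol d α θ) := by fun_prop
  exact (h1.indicator measurableSet_torusBox).comp (measurable_const_smul _)

lemma rescaledIntegrand_nonneg (α N r : ℝ) (θ : Fin d → ℝ) : 0 ≤ rescaledIntegrand α N r θ :=
  Set.indicator_nonneg (fun _ _ => Real.exp_nonneg _) _

lemma rescaledIntegrand_le {α c N r : ℝ} (hα0 : 0 < α)
    (hc : ∀ θ : Fin d → ℝ, ‖θ‖ ≤ Real.pi → c * ‖θ‖ ^ α ≤ -latticeSymbol d α θ)
    (hN : 0 < N) (hr : 0 ≤ r) (θ : Fin d → ℝ) :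
    rescaledIntegrand α N r θ ≤ Real.exp (-(r * c) * ‖θ‖ ^ α) := by
  refine Set.indicator_apply_le' (fun hθ => ?_) fun _ => Real.exp_nonneg _
  have h := hc _ (mem_torusBox_iff.1 hθ)
  have hε : 0 < N ^ (-(1 / α)) := Real.rpow_pos_of_pos hN _
  rw [norm_smul, Real.norm_of_nonneg hε.le, Real.mul_rpow hε.le (norm_nonneg θ),
    ← Real.rpow_mul hN.le, neg_mul, one_div_mul_cancel hα0.ne', Real.rpow_neg_one] at h
  refine Real.exp_le_exp.2 ?_
  have h2 := mul_le_mul_of_nonneg_left h (mul_nonneg hr hN.le)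
  have h3 : r * N * (c * (N⁻¹ * ‖θ‖ ^ α)) = r * c * ‖θ‖ ^ α := by
    field_simp
  linarith

lemma tendsto_rpow_neg_one_div_atTop {α : ℝ} (hα0 : 0 < α) :
    Tendsto (fun N : ℝ => N ^ (-(1 / α))) atTop (𝓝[>] 0) := by
  refine tendsto_nhdsWithin_iff.2 ⟨tendsto_rpow_neg_atTop (by positivity), ?_⟩
  filter_upwards [eventually_gt_atTop 0] with N hN
  exact Real.rpow_pos_of_pos hN _

lemma eventually_norm_smul_le_pi (θ : Fin d → ℝ) : ∀ᶠ ε in 𝓝[>] (0 : ℝ), ‖ε • θ‖ ≤ Real.pi := by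
  have h : Tendsto (fun ε : ℝ => ‖ε • θ‖) (𝓝 0) (𝓝 ‖(0 : ℝ) • θ‖) :=
    (by fun_prop : Continuous fun ε : ℝ => ‖ε • θ‖).tendsto 0
  rw [zero_smul, norm_zero] at h
  exact (h.mono_left nhdsWithin_le_nhds).eventually (eventually_le_nhds Real.pi_pos)

lemma tendsto_rescaledIntegrand [NeZero d] {α : ℝ} (hα0 : 0 < α) (hα2 : α < 2) (r : ℝ)
    (θ : Fin d → ℝ) :
    Tendsto (fun N => rescaledIntegrand α N r θ) atTop
      (𝓝 (Real.exp (-(r * l2norm θ ^ α * Gtilde d α)))) := by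
  have hε := tendsto_rpow_neg_one_div_atTop hα0
  have h := (tendsto_rpow_neg_mul_latticeSymbol hα0 hα2 θ).comp hε
  rw [integral_levyIntegrand hα0] at h
  have h2 := (Real.continuous_exp.tendsto _).comp (h.const_mul (-r))
  rw [show -(r * l2norm θ ^ α * Gtilde d α) = -r * (l2norm θ ^ α * Gtilde d α) by ring]
  refine h2.congr' ?_
  filter_upwards [eventually_gt_atTop 0, hε.eventually (eventually_norm_smul_le_pi θ)] with N hN hθ
  rw [rescaledIntegrand, Set.indicator_of_mem (mem_torusBox_iff.2 hθ)]
  have : (N ^ (-(1 / α))) ^ (-α) = N := by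
    rw [← Real.rpow_mul hN.le, neg_mul_neg, one_div_mul_cancel hα0.ne', Real.rpow_one]
  simp only [Function.comp_apply, this]
  congr 1
  ring

lemma fDensity_zero (α r : ℝ) : fDensity d α r 0 =
    ((2 * Real.pi) ^ d)⁻¹ * ∫ θ : Fin d → ℝ, Real.exp (-(r * l2norm θ ^ α * Gtilde d α)) := by
  simp [fDensity]

lemma tendsto_rpow_mul_pTrans [NeZero d] {α c r : ℝ} (hα0 : 0 < α) (hα2 : α < 2) (hc0 : 0 < c)
    (hc : ∀ θ : Fin d → ℝ, ‖θ‖ ≤ Real.pi → c * ‖θ‖ ^ α ≤ -latticeSymbol d α θ) (hr : 0 < r) :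
    Tendsto (fun N : ℝ => N ^ ((d : ℝ) / α) * pTrans d α (r * N) 0) atTop
      (𝓝 (fDensity d α r 0)) := by
  rw [fDensity_zero]
  have h : Tendsto (fun N : ℝ => ∫ θ : Fin d → ℝ, rescaledIntegrand α N r θ) atTop
      (𝓝 (∫ θ : Fin d → ℝ, Real.exp (-(r * l2norm θ ^ α * Gtilde d α)))) := by
    refine tendsto_integral_filter_of_dominated_convergence
      (fun θ => Real.exp (-(r * c) * ‖θ‖ ^ α)) ?_ ?_
      (integrable_exp_neg_mul_norm_rpow hα0 (mul_pos hr hc0)) ?_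
    · exact Eventually.of_forall fun N =>
        (measurable_rescaledIntegrand hα0 hα2 N r).aestronglyMeasurable
    · filter_upwards [eventually_gt_atTop 0] with N hN
      refine Eventually.of_forall fun θ => ?_
      rw [Real.norm_of_nonneg (rescaledIntegrand_nonneg _ _ _ _)]
      exact rescaledIntegrand_le hα0 hc hN hr.le θ
    · exact Eventually.of_forall fun θ => tendsto_rescaledIntegrand hα0 hα2 r θ
  refine (h.const_mul _).congr' ?_
  filter_upwards [eventually_gt_atTop 0] with N hN
  exact (rpow_mul_pTrans_eq hN r).symm

lemma abs_rpow_mul_pTrans_le [NeZero d] {α c r N : ℝ} (hα0 : 0 < α) (hc0 : 0 < c)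
    (hc : ∀ θ : Fin d → ℝ, ‖θ‖ ≤ Real.pi → c * ‖θ‖ ^ α ≤ -latticeSymbol d α θ)
    (hr : 0 < r) (hN : 0 < N) :
    |N ^ ((d : ℝ) / α) * pTrans d α (r * N) 0| ≤
      ((2 * Real.pi) ^ d)⁻¹ * (∫ θ : Fin d → ℝ, Real.exp (-c * ‖θ‖ ^ α)) *
        r ^ (-((d : ℝ) / α)) := by
  rw [rpow_mul_pTrans_eq hN, abs_of_nonneg (mul_nonneg (by positivity)
    (integral_nonneg fun θ => rescaledIntegrand_nonneg _ _ _ _)), mul_assoc,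
    mul_comm (∫ θ : Fin d → ℝ, Real.exp (-c * ‖θ‖ ^ α)),
    ← integral_exp_neg_mul_norm_rpow hα0 hr]
  refine mul_le_mul_of_nonneg_left ?_ (by positivity)
  exact integral_mono_of_nonneg (Eventually.of_forall fun θ => rescaledIntegrand_nonneg _ _ _ _)
    (integrable_exp_neg_mul_norm_rpow hα0 (mul_pos hr hc0))
    (Eventually.of_forall fun θ => rescaledIntegrand_le hα0 hc hN hr.le θ)

lemma measurable_pTrans_zero [NeZero d] {α : ℝ} (hα0 : 0 < α) (hα2 : α < 2) :
    Measurable fun r => pTrans d α r 0 := by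
  have h : Measurable (latticeSymbol d α) := (continuous_latticeSymbol hα0 hα2).measurable
  have hf : Measurable fun p : ℝ × (Fin d → ℝ) => Real.exp (p.1 * latticeSymbol d α p.2) := by
    fun_prop
  simp only [pTrans, Pi.zero_apply, Int.cast_zero, zero_mul, Finset.sum_const_zero, Real.cos_zero,
    mul_one]
  exact (hf.stronglyMeasurable.integral_prod_right').measurable.const_mul _

lemma measurable_fDensity_zero (α : ℝ) : Measurable fun r => fDensity d α r 0 := by
  have h : Measurable (l2norm : (Fin d → ℝ) → ℝ) := continuous_l2norm.measurable
  have hf : Measurable fun p : ℝ × (Fin d → ℝ) =>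
      Real.exp (-(p.1 * l2norm p.2 ^ α * Gtilde d α)) := by
    fun_prop
  simp only [fDensity_zero]
  exact (hf.stronglyMeasurable.integral_prod_right').measurable.const_mul _

end HeatKernelLimit

section DoubleTimeIntegral

lemma restrict_Icc_prod_Icc (t : ℝ) :
    (volume : Measure (ℝ × ℝ)).restrict (Set.Icc 0 t ×ˢ Set.Icc 0 t) =
      (volume.restrict (Set.Ioc 0 t)).prod (volume.restrict (Set.Ioc 0 t)) := by
  rw [Measure.volume_eq_prod, ← Measure.prod_restrict, ← Measure.restrict_congr_set Ioc_ae_eq_Icc]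

lemma ae_pos_of_restrict_Icc_prod_Icc (t : ℝ) :
    ∀ᵐ p ∂(volume : Measure (ℝ × ℝ)).restrict (Set.Icc 0 t ×ˢ Set.Icc 0 t), 0 < p.1 ∧ 0 < p.2 := by
  rw [restrict_Icc_prod_Icc, Measure.prod_restrict]
  filter_upwards [ae_restrict_mem (measurableSet_Ioc.prod measurableSet_Ioc)] with p hp
  exact ⟨hp.1.1, hp.2.1⟩

lemma add_rpow_neg_le {γ s v : ℝ} (hγ : 0 ≤ γ) (hs : 0 < s) (hv : 0 < v) :
    (s + v) ^ (-γ) ≤ s ^ (-(γ / 2)) * v ^ (-(γ / 2)) := by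
  have hsv : 0 < s * v := mul_pos hs hv
  have h1 : √(s * v) ≤ s + v := Real.sqrt_le_iff.2 ⟨by positivity, by nlinarith⟩
  calc (s + v) ^ (-γ) ≤ √(s * v) ^ (-γ) :=
        Real.rpow_le_rpow_of_nonpos (Real.sqrt_pos.2 hsv) h1 (by linarith)
    _ = s ^ (-(γ / 2)) * v ^ (-(γ / 2)) := by
        rw [Real.sqrt_eq_rpow, ← Real.rpow_mul hsv.le, ← Real.mul_rpow hs.le hv.le]
        congr 1
        ring

lemma integrableOn_add_rpow_neg {γ t : ℝ} (hγ0 : 0 ≤ γ) (hγ2 : γ < 2) (ht : 0 ≤ t) :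
    IntegrableOn (fun p : ℝ × ℝ => (p.1 + p.2) ^ (-γ)) (Set.Icc 0 t ×ˢ Set.Icc 0 t) := by
  have h1 : IntegrableOn (fun r : ℝ => r ^ (-(γ / 2))) (Set.Ioc 0 t) :=
    (intervalIntegrable_iff_integrableOn_Ioc_of_le ht).1
      (intervalIntegral.intervalIntegrable_rpow' (by linarith))
  have h2 : IntegrableOn (fun p : ℝ × ℝ => p.1 ^ (-(γ / 2)) * p.2 ^ (-(γ / 2)))
      (Set.Icc 0 t ×ˢ Set.Icc 0 t) := by
    rw [IntegrableOn, restrict_Icc_prod_Icc]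
    exact Integrable.mul_prod h1 h1
  refine Integrable.mono' h2
    (by fun_prop : Measurable fun p : ℝ × ℝ => (p.1 + p.2) ^ (-γ)).aestronglyMeasurable ?_
  filter_upwards [ae_pos_of_restrict_Icc_prod_Icc t] with p hp
  have := add_pos hp.1 hp.2
  rw [Real.norm_of_nonneg (Real.rpow_nonneg this.le _)]
  exact add_rpow_neg_le hγ0 hp.1 hp.2

lemma setIntegral_Icc_prod_Icc {F : ℝ → ℝ} {t : ℝ}
    (hF : IntegrableOn (fun p : ℝ × ℝ => F (p.1 + p.2)) (Set.Icc 0 t ×ˢ Set.Icc 0 t)) :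
    ∫ p in Set.Icc 0 t ×ˢ Set.Icc 0 t, F (p.1 + p.2) =
      ∫ s in Set.Icc 0 t, ∫ v in Set.Icc 0 t, F (s + v) := by
  rw [Measure.volume_eq_prod] at hF ⊢
  exact setIntegral_prod _ hF

end DoubleTimeIntegral

/-- **Convergence of the rescaled double time integral (equation 4.8)**: for `d ∈ {1,2,3}`,
`α ∈ (d/2, min(d,2))` and `t > 0`, `∫_0^t∫_0^t f_{s+v}^{d,α}(0) ds dv` is finite and
`lim_{N→∞} N^{d/α} ∫_0^t∫_0^t p_{(s+v)N}^{d,α}(0,0) ds dv = ∫_0^t∫_0^t f_{s+v}^{d,α}(0) ds dv`. -/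
theorem rescaled_double_time_integral (d : ℕ) (hd1 : 1 ≤ d) (hd3 : d ≤ 3)
    (α : ℝ) (hα1 : (d : ℝ) / 2 < α) (hα2 : α < min (d : ℝ) 2) (t : ℝ) (ht : 0 < t) :
    IntegrableOn
      (fun p : ℝ × ℝ => fDensity d α (p.1 + p.2) (0 : Fin d → ℝ))
      (Set.Icc 0 t ×ˢ Set.Icc 0 t) ∧
    Tendsto
      (fun N : ℝ => N ^ ((d : ℝ) / α) *
        ∫ s in Set.Icc (0 : ℝ) t, ∫ v in Set.Icc (0 : ℝ) t,
          pTrans d α ((s + v) * N) (0 : Fin d → ℤ))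
      atTop
      (𝓝 (∫ s in Set.Icc (0 : ℝ) t, ∫ v in Set.Icc (0 : ℝ) t,
        fDensity d α (s + v) (0 : Fin d → ℝ))) := by
  have hd0 : 0 < (d : ℝ) := by exact_mod_cast hd1
  have hα0 : 0 < α := by linarith
  have hα2' : α < 2 := hα2.trans_le (min_le_right _ _)
  have : NeZero d := ⟨by omega⟩
  obtain ⟨c, hc0, hc⟩ := exists_mul_norm_rpow_le_neg_latticeSymbol (d := d) hd3 hα0 hα2'
  set C := ((2 * Real.pi) ^ d)⁻¹ * ∫ θ : Fin d → ℝ, Real.exp (-c * ‖θ‖ ^ α)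
  have hmaj : IntegrableOn (fun p : ℝ × ℝ => C * (p.1 + p.2) ^ (-((d : ℝ) / α)))
      (Set.Icc 0 t ×ˢ Set.Icc 0 t) := by
    refine (integrableOn_add_rpow_neg (by positivity) ?_ ht.le).const_mul C
    rw [div_lt_iff₀ hα0]
    linarith
  have hpm := measurable_pTrans_zero (d := d) hα0 hα2'
  have hfm := measurable_fDensity_zero (d := d) α
  have hf : IntegrableOn (fun p : ℝ × ℝ => fDensity d α (p.1 + p.2) (0 : Fin d → ℝ))
      (Set.Icc 0 t ×ˢ Set.Icc 0 t) := by
    refine Integrable.mono' hmaj (hfm.comp (by fun_prop)).aestronglyMeasurable ?_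
    filter_upwards [ae_pos_of_restrict_Icc_prod_Icc t] with p hp
    have hr := add_pos hp.1 hp.2
    refine le_of_tendsto (tendsto_rpow_mul_pTrans hα0 hα2' hc0 hc hr).norm ?_
    filter_upwards [eventually_gt_atTop 0] with N hN
    exact abs_rpow_mul_pTrans_le hα0 hc0 hc hr hN
  refine ⟨hf, ?_⟩
  have hp_meas : ∀ N : ℝ, Measurable fun p : ℝ × ℝ =>
      N ^ ((d : ℝ) / α) * pTrans d α ((p.1 + p.2) * N) 0 := fun N =>
    (hpm.comp (by fun_prop : Measurable fun p : ℝ × ℝ => (p.1 + p.2) * N)).const_mul _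
  have hp_le : ∀ N : ℝ, 0 < N →
      ∀ᵐ p ∂(volume : Measure (ℝ × ℝ)).restrict (Set.Icc 0 t ×ˢ Set.Icc 0 t),
        ‖N ^ ((d : ℝ) / α) * pTrans d α ((p.1 + p.2) * N) 0‖ ≤
          C * (p.1 + p.2) ^ (-((d : ℝ) / α)) := fun N hN => by
    filter_upwards [ae_pos_of_restrict_Icc_prod_Icc t] with p hp
    exact abs_rpow_mul_pTrans_le hα0 hc0 hc (add_pos hp.1 hp.2) hN
  rw [← setIntegral_Icc_prod_Icc (F := fun r => fDensity d α r 0) hf]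
  have hlim : Tendsto (fun N : ℝ => ∫ p in Set.Icc (0 : ℝ) t ×ˢ Set.Icc (0 : ℝ) t,
      N ^ ((d : ℝ) / α) * pTrans d α ((p.1 + p.2) * N) 0) atTop
      (𝓝 (∫ p in Set.Icc (0 : ℝ) t ×ˢ Set.Icc (0 : ℝ) t, fDensity d α (p.1 + p.2) 0)) := by
    refine tendsto_integral_filter_of_dominated_convergence _
      (Eventually.of_forall fun N => (hp_meas N).aestronglyMeasurable) ?_ hmaj ?_
    · filter_upwards [eventually_gt_atTop 0] with N hN using hp_le N hN
    · filter_upwards [ae_pos_of_restrict_Icc_prod_Icc t] with p hp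
      exact tendsto_rpow_mul_pTrans hα0 hα2' hc0 hc (add_pos hp.1 hp.2)
  refine hlim.congr' ?_
  filter_upwards [eventually_gt_atTop 0] with N hN
  have hint : IntegrableOn (fun p : ℝ × ℝ =>
      N ^ ((d : ℝ) / α) * pTrans d α ((p.1 + p.2) * N) 0) (Set.Icc 0 t ×ˢ Set.Icc 0 t) :=
    hmaj.mono' (hp_meas N).aestronglyMeasurable (hp_le N hN)
  rw [setIntegral_Icc_prod_Icc
    (F := fun r => N ^ ((d : ℝ) / α) * pTrans d α (r * N) 0) hint]
  simp only [integral_const_mul]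
end

section
/- Triple integral bound in the critical case d = 3, α = 2 (equation 5.8): there exists a constant C < +∞ such that for all real s ≥ 1000, ∫_0^s ( ∫_0^r ( ∫_0^{+∞} p_{θ+v}^{3,2}(0,0) dv ) dθ ) dr ≤ C · s^{3/2} · (log s)^{−3/2}. -/
open MeasureTheory Filter Real Topology

/-- The summand of the symbol of the walk, with the opposite sign. -/
noncomputable def symbolTerm (θ : Fin 3 → ℝ) (y : Fin 3 → ℤ) : ℝ :=
  (1 - Real.cos (∑ i, θ i * (y i : ℝ))) / zl2 y ^ 5

lemma zl2_nonneg {d : ℕ} (y : Fin d → ℤ) : 0 ≤ zl2 y := Real.sqrt_nonneg _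

lemma zl2_sq {d : ℕ} (y : Fin d → ℤ) : zl2 y ^ 2 = ∑ i, (y i : ℝ) ^ 2 :=
  Real.sq_sqrt (Finset.sum_nonneg fun _ _ => sq_nonneg _)

lemma abs_le_zl2 {d : ℕ} (y : Fin d → ℤ) (i : Fin d) : |(y i : ℝ)| ≤ zl2 y := by
  apply abs_le_of_sq_le_sq _ (zl2_nonneg y)
  rw [zl2_sq]
  exact Finset.single_le_sum (f := fun i => (y i : ℝ) ^ 2) (fun _ _ => sq_nonneg _)
    (Finset.mem_univ i)

lemma symbolTerm_nonneg (θ : Fin 3 → ℝ) (y : Fin 3 → ℤ) : 0 ≤ symbolTerm θ y :=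
  div_nonneg (sub_nonneg.2 (Real.cos_le_one _)) (pow_nonneg (zl2_nonneg y) 5)

lemma summable_inv_zl2_pow_five : Summable fun y : Fin 3 → ℤ => (zl2 y ^ 5)⁻¹ := by
  let b := Pi.basisFun ℝ (Fin 3)
  let L : Submodule ℤ (Fin 3 → ℝ) := Submodule.span ℤ (Set.range b)
  have hL : Module.finrank ℤ L < 5 := by
    rw [ZLattice.rank ℝ L]
    simp
  have hsum := ZLattice.summable_norm_pow_inv (L := L) 5 hL
  have hmem : ∀ y : Fin 3 → ℤ, (fun i => (y i : ℝ)) ∈ L := fun y => by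
    rw [Module.Basis.mem_span_iff_repr_mem]
    intro i
    simp [b]
  let φ : (Fin 3 → ℤ) → L := fun y => ⟨fun i => (y i : ℝ), hmem y⟩
  have hφ : Function.Injective φ := fun y z h => by
    have h' := congrArg Subtype.val h
    funext i
    exact Int.cast_injective (α := ℝ) (congrFun h' i)
  refine Summable.of_nonneg_of_le (fun y => inv_nonneg.2 (pow_nonneg (zl2_nonneg y) 5))
    (fun y => ?_) (hsum.comp_injective hφ)
  rcases eq_or_ne y 0 with rfl | hy
  · simp [zl2, l2norm]
  have hpos : 0 < ‖φ y‖ := norm_pos_iff.2 fun h => hy <| hφ <| by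
    rw [h]
    ext i
    simp [φ]
  have hle : ‖φ y‖ ≤ zl2 y :=
    (pi_norm_le_iff_of_nonneg (zl2_nonneg y)).2 fun i => abs_le_zl2 y i
  simp only [Function.comp, inv_pow]
  exact inv_anti₀ (pow_pos hpos 5) (pow_le_pow_left₀ hpos.le hle 5)

lemma summable_symbolTerm (θ : Fin 3 → ℝ) : Summable (symbolTerm θ) := by
  refine Summable.of_nonneg_of_le (symbolTerm_nonneg θ) (fun y => ?_)
    (summable_inv_zl2_pow_five.mul_left 2)
  rw [symbolTerm, div_eq_mul_inv]
  have := Real.neg_one_le_cos (∑ i, θ i * (y i : ℝ))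
  have := zl2_nonneg y
  gcongr
  linarith

lemma latticeSymbol_eq (θ : Fin 3 → ℝ) : latticeSymbol 3 2 θ = -∑' y, symbolTerm θ y := by
  rw [latticeSymbol, ← tsum_neg]
  have hsupp : Function.support (fun y => -symbolTerm θ y) ⊆ {y : Fin 3 → ℤ | y ≠ 0} := by
    rintro y hy rfl
    simp [symbolTerm] at hy
  rw [← tsum_subtype_eq_of_support_subset hsupp]
  refine tsum_congr fun y => ?_
  rw [symbolTerm, ← neg_div, neg_sub]
  congr 1
  rw [← Real.rpow_natCast]
  norm_num

lemma sum_symbolTerm_le (θ : Fin 3 → ℝ) (F : Finset (Fin 3 → ℤ)) :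
    ∑ y ∈ F, symbolTerm θ y ≤ -latticeSymbol 3 2 θ := by
  rw [latticeSymbol_eq, neg_neg]
  exact (summable_symbolTerm θ).sum_le_tsum F fun y _ => symbolTerm_nonneg θ y

lemma mul_sq_le_symbolTerm {θ : Fin 3 → ℝ} {y : Fin 3 → ℤ} (h : |∑ i, θ i * (y i : ℝ)| ≤ π) :
    2 / π ^ 2 * ((∑ i, θ i * (y i : ℝ)) ^ 2 * (zl2 y ^ 5)⁻¹) ≤ symbolTerm θ y := by
  rw [symbolTerm, div_eq_mul_inv (1 - _), ← mul_assoc]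
  have := Real.cos_le_one_sub_mul_cos_sq h
  exact mul_le_mul_of_nonneg_right (by linarith) (inv_nonneg.2 (pow_nonneg (zl2_nonneg y) 5))

/-- Quadratic lower bound for the symbol on the Brillouin zone. -/
lemma mul_sum_sq_le_neg_latticeSymbol {θ : Fin 3 → ℝ} (hθ : ∀ i, |θ i| ≤ π) :
    2 / (3 * π ^ 2) * ∑ i, θ i ^ 2 ≤ -latticeSymbol 3 2 θ := by
  have h : ∀ i, 2 / π ^ 2 * θ i ^ 2 ≤ -latticeSymbol 3 2 θ := fun i => by
    have h1 : ∑ j, θ j * ((Pi.single i 1 : Fin 3 → ℤ) j : ℝ) = θ i := by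
      simp [Pi.single_apply]
    have h2 : zl2 (Pi.single i 1 : Fin 3 → ℤ) = 1 := by
      simp [zl2, l2norm, Pi.single_apply]
    have h3 := mul_sq_le_symbolTerm (θ := θ) (y := Pi.single i 1) (by rw [h1]; exact hθ i)
    rw [h1, h2] at h3
    have h4 := sum_symbolTerm_le θ {Pi.single i 1}
    rw [Finset.sum_singleton] at h4
    linarith
  have h' := Finset.sum_le_sum fun i (_ : i ∈ Finset.univ) => h i
  rw [← Finset.mul_sum, Finset.sum_const] at h'
  simp only [Finset.card_univ, Fintype.card_fin, nsmul_eq_mul] at h'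
  have : 2 / (3 * π ^ 2) * ∑ i, θ i ^ 2 = (2 / π ^ 2 * ∑ i, θ i ^ 2) / 3 := by
    field_simp
  push_cast at h'
  linarith

/-- The lattice points whose coordinates are at most `N` in absolute value. -/
noncomputable def latticeBox (N : ℕ) : Finset (Fin 3 → ℤ) :=
  Fintype.piFinset fun _ => Finset.Icc (-(N : ℤ)) N

lemma mem_latticeBox {N : ℕ} {y : Fin 3 → ℤ} :
    y ∈ latticeBox N ↔ ∀ i, -(N : ℤ) ≤ y i ∧ y i ≤ N := by
  simp [latticeBox]

/-- Reflecting one coordinate makes the cross terms of the quadratic form harmless. -/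
lemma sum_latticeBox_sq_le (θ : Fin 3 → ℝ) (N : ℕ) (i : Fin 3) :
    θ i ^ 2 * ∑ y ∈ latticeBox N, (y i : ℝ) ^ 2 * (zl2 y ^ 5)⁻¹ ≤
      ∑ y ∈ latticeBox N, (∑ j, θ j * (y j : ℝ)) ^ 2 * (zl2 y ^ 5)⁻¹ := by
  let σ : (Fin 3 → ℤ) → Fin 3 → ℤ := fun y => Function.update y i (-y i)
  have hσ : Function.Involutive σ := fun y => by simp [σ]
  have hσz : ∀ y, zl2 (σ y) = zl2 y := fun y => by
    simp only [zl2, l2norm]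
    congr 1
    refine Finset.sum_congr rfl fun j _ => ?_
    by_cases hj : j = i
    · subst hj; simp [σ]
    · simp [σ, hj]
  have hσs : ∀ y, ∑ j, θ j * (σ y j : ℝ) = ∑ j, θ j * (y j : ℝ) - 2 * (θ i * (y i : ℝ)) := by
    intro y
    rw [← Finset.add_sum_erase _ _ (Finset.mem_univ i),
      ← Finset.add_sum_erase _ (fun j => θ j * (y j : ℝ)) (Finset.mem_univ i)]
    have : ∑ j ∈ Finset.univ.erase i, θ j * (σ y j : ℝ)
        = ∑ j ∈ Finset.univ.erase i, θ j * (y j : ℝ) :=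
      Finset.sum_congr rfl fun j hj => by simp [σ, Finset.ne_of_mem_erase hj]
    rw [this]
    simp [σ]
    ring
  have hσm : ∀ y ∈ latticeBox N, σ y ∈ latticeBox N := fun y hy => by
    rw [mem_latticeBox] at hy ⊢
    intro j
    by_cases hj : j = i
    · subst hj
      have := hy j
      simp [σ]
      omega
    · simpa [σ, hj] using hy j
  have hsymm : ∑ y ∈ latticeBox N, (∑ j, θ j * (y j : ℝ)) ^ 2 * (zl2 y ^ 5)⁻¹ =
      ∑ y ∈ latticeBox N, (∑ j, θ j * (σ y j : ℝ)) ^ 2 * (zl2 y ^ 5)⁻¹ := by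
    refine Finset.sum_nbij' σ σ hσm hσm (fun y _ => hσ y) (fun y _ => hσ y) fun y _ => ?_
    rw [hσ y, hσz]
  have hkey : 2 * (θ i ^ 2 * ∑ y ∈ latticeBox N, (y i : ℝ) ^ 2 * (zl2 y ^ 5)⁻¹) ≤
      ∑ y ∈ latticeBox N, (∑ j, θ j * (y j : ℝ)) ^ 2 * (zl2 y ^ 5)⁻¹ +
      ∑ y ∈ latticeBox N, (∑ j, θ j * (σ y j : ℝ)) ^ 2 * (zl2 y ^ 5)⁻¹ := by
    rw [Finset.mul_sum, Finset.mul_sum, ← Finset.sum_add_distrib]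
    refine Finset.sum_le_sum fun y _ => ?_
    rw [hσs, ← add_mul, ← mul_assoc, ← mul_assoc]
    have := zl2_nonneg y
    gcongr
    nlinarith [sq_nonneg (∑ j, θ j * (y j : ℝ) - θ i * (y i : ℝ))]
  linarith

lemma harmonic_le_sum_latticeBox (N : ℕ) (i : Fin 3) :
    (harmonic N : ℝ) / 32 ≤ ∑ y ∈ latticeBox N, (y i : ℝ) ^ 2 * (zl2 y ^ 5)⁻¹ := by
  let φ : (Σ _ : ℕ, ℕ × ℕ) → Fin 3 → ℤ := fun p k =>
    if k = i then (p.1 : ℤ) + 1 else if k = i + 1 then p.2.1 else p.2.2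
  let S : Finset (Σ _ : ℕ, ℕ × ℕ) :=
    (Finset.range N).sigma fun n => Finset.range (n + 1) ×ˢ Finset.range (n + 1)
  have hi1 : i + 1 ≠ i := by revert i; decide
  have hi2 : i + 2 ≠ i := by revert i; decide
  have hi3 : i + 2 ≠ i + 1 := by revert i; decide
  have hφ0 : ∀ p, φ p i = (p.1 : ℤ) + 1 := fun p => by simp [φ]
  have hφ1 : ∀ p, φ p (i + 1) = (p.2.1 : ℤ) := fun p => by simp [φ]
  have hφ2 : ∀ p, φ p (i + 2) = (p.2.2 : ℤ) := fun p => by simp [φ]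
  have hinj : Function.Injective φ := by
    rintro ⟨n, a, b⟩ ⟨n', a', b'⟩ h
    have e0 := congrFun h i
    have e1 := congrFun h (i + 1)
    have e2 := congrFun h (i + 2)
    rw [hφ0, hφ0] at e0
    rw [hφ1, hφ1] at e1
    rw [hφ2, hφ2] at e2
    simp only at e0 e1 e2
    obtain rfl : n = n' := by omega
    obtain rfl : a = a' := by omega
    obtain rfl : b = b' := by omega
    rfl
  have hbd : ∀ p ∈ S, ∀ k, 0 ≤ φ p k ∧ φ p k ≤ (p.1 : ℤ) + 1 := fun p hp k => by
    simp only [S, Finset.mem_sigma, Finset.mem_product, Finset.mem_range] at hp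
    simp only [φ]
    split_ifs <;> omega
  have hsub : S.image φ ⊆ latticeBox N := by
    intro y hy
    obtain ⟨p, hp, rfl⟩ := Finset.mem_image.1 hy
    rw [mem_latticeBox]
    intro k
    have := hbd p hp k
    simp only [S, Finset.mem_sigma, Finset.mem_range] at hp
    omega
  have hterm : ∀ p ∈ S, (((p.1 : ℝ) + 1) ^ 3)⁻¹ / 32 ≤
      (φ p i : ℝ) ^ 2 * (zl2 (φ p) ^ 5)⁻¹ := fun p hp => by
    have hpos : (0 : ℝ) < (p.1 : ℝ) + 1 := by positivity
    have hle : zl2 (φ p) ≤ 2 * ((p.1 : ℝ) + 1) := by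
      apply le_of_sq_le_sq _ (by positivity)
      rw [zl2_sq]
      have : ∀ k ∈ Finset.univ, (φ p k : ℝ) ^ 2 ≤ ((p.1 : ℝ) + 1) ^ 2 := fun k _ => by
        have := hbd p hp k
        have h0 : (0 : ℝ) ≤ φ p k := by exact_mod_cast this.1
        have h1 : (φ p k : ℝ) ≤ (p.1 : ℝ) + 1 := by exact_mod_cast this.2
        gcongr
      have := Finset.sum_le_sum this
      simp only [Finset.sum_const, Finset.card_univ, Fintype.card_fin, nsmul_eq_mul] at this
      push_cast at this
      nlinarith
    have hz : 0 < zl2 (φ p) := lt_of_lt_of_le (by rw [hφ0]; push_cast; positivity)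
      (abs_le_zl2 (φ p) i)
    rw [hφ0]
    push_cast
    calc (((p.1 : ℝ) + 1) ^ 3)⁻¹ / 32
        = ((p.1 : ℝ) + 1) ^ 2 * ((2 * ((p.1 : ℝ) + 1)) ^ 5)⁻¹ := by field_simp; ring
      _ ≤ _ := by gcongr
  calc (harmonic N : ℝ) / 32
      = ∑ p ∈ S, (((p.1 : ℝ) + 1) ^ 3)⁻¹ / 32 := by
        rw [Finset.sum_sigma, harmonic]
        push_cast
        rw [Finset.sum_div]
        refine Finset.sum_congr rfl fun n _ => ?_
        simp only [Finset.sum_const, Finset.card_product, Finset.card_range, nsmul_eq_mul]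
        push_cast
        field_simp
    _ ≤ ∑ p ∈ S, (φ p i : ℝ) ^ 2 * (zl2 (φ p) ^ 5)⁻¹ := Finset.sum_le_sum hterm
    _ = ∑ y ∈ S.image φ, (y i : ℝ) ^ 2 * (zl2 y ^ 5)⁻¹ :=
        (Finset.sum_image (f := fun y : Fin 3 → ℤ => (y i : ℝ) ^ 2 * (zl2 y ^ 5)⁻¹)
          fun _ _ _ _ h => hinj h).symm
    _ ≤ _ := Finset.sum_le_sum_of_subset_of_nonneg hsub fun y _ _ => by
        have := zl2_nonneg y
        positivity

lemma harmonic_mul_le_neg_latticeSymbol {θ : Fin 3 → ℝ} {N : ℕ}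
    (h : 3 * (N : ℝ) ^ 2 * ∑ i, θ i ^ 2 ≤ π ^ 2) :
    (harmonic N : ℝ) / (48 * π ^ 2) * ∑ i, θ i ^ 2 ≤ -latticeSymbol 3 2 θ := by
  set T := ∑ y ∈ latticeBox N, (∑ j, θ j * (y j : ℝ)) ^ 2 * (zl2 y ^ 5)⁻¹ with hT
  have h1 : 2 / π ^ 2 * T ≤ -latticeSymbol 3 2 θ := by
    refine le_trans ?_ (sum_symbolTerm_le θ (latticeBox N))
    rw [hT, Finset.mul_sum]
    refine Finset.sum_le_sum fun y hy => mul_sq_le_symbolTerm ?_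
    refine abs_le_of_sq_le_sq ?_ Real.pi_pos.le
    refine (Finset.sum_mul_sq_le_sq_mul_sq _ _ _).trans (le_trans ?_ h)
    rw [mul_comm]
    have hQ : 0 ≤ ∑ i, θ i ^ 2 := Finset.sum_nonneg fun _ _ => sq_nonneg _
    gcongr
    have : ∀ k ∈ Finset.univ, (y k : ℝ) ^ 2 ≤ (N : ℝ) ^ 2 := fun k _ => by
      have := (mem_latticeBox.1 hy) k
      apply sq_le_sq'
      · exact_mod_cast this.1
      · exact_mod_cast this.2
    have := Finset.sum_le_sum this
    simpa using this
  have h2 : ∀ i ∈ Finset.univ, θ i ^ 2 * ((harmonic N : ℝ) / 32) ≤ T := fun i _ =>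
    (mul_le_mul_of_nonneg_left (harmonic_le_sum_latticeBox N i) (sq_nonneg _)).trans
      (sum_latticeBox_sq_le θ N i)
  have h3 := Finset.sum_le_sum h2
  rw [← Finset.sum_mul] at h3
  simp only [Finset.sum_const, Finset.card_univ, Fintype.card_fin, nsmul_eq_mul] at h3
  push_cast at h3
  refine le_trans ?_ h1
  have : (harmonic N : ℝ) / (48 * π ^ 2) * ∑ i, θ i ^ 2
      = 2 / π ^ 2 * (((∑ i, θ i ^ 2) * ((harmonic N : ℝ) / 32)) / 3) := by
    field_simp
    ring
  rw [this]
  gcongr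
  linarith

/-- Lower bound for the symbol near the origin, with the logarithmic correction of the
critical case. -/
lemma log_mul_le_neg_latticeSymbol {θ : Fin 3 → ℝ} {s : ℝ} (hs : 1 ≤ s)
    (h : ∑ i, θ i ^ 2 ≤ s ^ (-(1 / 2) : ℝ)) :
    Real.log s / (192 * π ^ 2) * ∑ i, θ i ^ 2 ≤ -latticeSymbol 3 2 θ := by
  have hs0 : 0 < s := by linarith
  set N := ⌊s ^ (1 / 4 : ℝ)⌋₊ with hN
  have hx : (0 : ℝ) ≤ s ^ (1 / 4 : ℝ) := by positivity
  have hQ : 0 ≤ ∑ i, θ i ^ 2 := Finset.sum_nonneg fun _ _ => sq_nonneg _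
  have hNle : (N : ℝ) ^ 2 ≤ s ^ (1 / 2 : ℝ) := by
    calc (N : ℝ) ^ 2 ≤ (s ^ (1 / 4 : ℝ)) ^ 2 := by gcongr; exact Nat.floor_le hx
      _ = s ^ (1 / 2 : ℝ) := by rw [← Real.rpow_mul_natCast hs0.le]; norm_num
  have hprod : s ^ (1 / 2 : ℝ) * s ^ (-(1 / 2) : ℝ) = 1 := by
    rw [← Real.rpow_add hs0]; norm_num
  have h1 : 3 * (N : ℝ) ^ 2 * ∑ i, θ i ^ 2 ≤ π ^ 2 := by
    have : (N : ℝ) ^ 2 * ∑ i, θ i ^ 2 ≤ 1 := by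
      rw [← hprod]; gcongr
    nlinarith [Real.pi_gt_three]
  have h2 : Real.log s / 4 ≤ (harmonic N : ℝ) := by
    refine le_trans ?_ (log_add_one_le_harmonic N)
    have h4 : Real.log (s ^ (1 / 4 : ℝ)) = Real.log s / 4 := by
      rw [Real.log_rpow hs0]; ring
    rw [← h4]
    apply Real.log_le_log (by positivity)
    push_cast
    exact (Nat.lt_floor_add_one _).le
  refine le_trans ?_ (harmonic_mul_le_neg_latticeSymbol h1)
  have h3 : Real.log s / (192 * π ^ 2) = Real.log s / 4 / (48 * π ^ 2) := by field_simp; ring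
  rw [h3]
  gcongr

lemma exp_neg_mul_sum_sq {ι : Type*} [Fintype ι] (b : ℝ) (θ : ι → ℝ) :
    Real.exp (-(b * ∑ i, θ i ^ 2)) = ∏ i, Real.exp (-b * θ i ^ 2) := by
  rw [← Real.exp_sum, ← Finset.mul_sum, neg_mul]

lemma integrable_exp_neg_mul_sum_sq {ι : Type*} [Fintype ι] {b : ℝ} (hb : 0 < b) :
    Integrable fun θ : ι → ℝ => Real.exp (-(b * ∑ i, θ i ^ 2)) := by
  simp_rw [exp_neg_mul_sum_sq]
  exact Integrable.fintype_prod fun _ => integrable_exp_neg_mul_sq hb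

lemma integral_exp_neg_mul_sum_sq {b : ℝ} (hb : 0 < b) :
    ∫ θ : Fin 3 → ℝ, Real.exp (-(b * ∑ i, θ i ^ 2)) = (π / b) ^ (3 / 2 : ℝ) := by
  simp_rw [exp_neg_mul_sum_sq]
  rw [integral_fintype_prod_volume_eq_pow (fun x : ℝ => Real.exp (-b * x ^ 2)), integral_gaussian,
    Fintype.card_fin, Real.sqrt_eq_rpow, ← Real.rpow_mul_natCast (by positivity)]
  norm_num

lemma exp_neg_le_rpow {x : ℝ} (hx : 0 < x) : Real.exp (-x) ≤ x ^ (-(1 / 4) : ℝ) := by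
  rw [Real.exp_neg, Real.rpow_neg hx.le]
  apply inv_anti₀ (by positivity)
  refine le_trans ?_ (Real.add_one_le_exp x)
  rcases le_total x 1 with h | h
  · have := Real.rpow_le_one hx.le h (by norm_num : (0 : ℝ) ≤ 1 / 4)
    linarith
  · have := Real.rpow_le_rpow_of_exponent_le h (by norm_num : (1 / 4 : ℝ) ≤ 1)
    rw [Real.rpow_one] at this
    linarith

lemma pTrans_zero (d : ℕ) (α t : ℝ) :
    pTrans d α t 0 = ((2 * π) ^ d)⁻¹ *
      ∫ θ in Set.univ.pi (fun _ : Fin d => Set.Icc (-π) π), Real.exp (t * latticeSymbol d α θ) := by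
  simp [pTrans]

lemma pTrans_zero_nonneg (d : ℕ) (α t : ℝ) : 0 ≤ pTrans d α t 0 := by
  rw [pTrans_zero]
  exact mul_nonneg (by positivity) (integral_nonneg fun _ => (Real.exp_pos _).le)

lemma exp_mul_latticeSymbol_le {θ : Fin 3 → ℝ} (hθ : ∀ i, |θ i| ≤ π) {s t : ℝ} (hs : 1 ≤ s)
    (ht : 0 < t) :
    Real.exp (t * latticeSymbol 3 2 θ) ≤
      Real.exp (-(t * (Real.log s / (192 * π ^ 2)) * ∑ i, θ i ^ 2)) +
      (t * (1 / (3 * π ^ 2)) * s ^ (-(1 / 2) : ℝ)) ^ (-(1 / 4) : ℝ) *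
        Real.exp (-(t * (1 / (3 * π ^ 2)) * ∑ i, θ i ^ 2)) := by
  have hs0 : 0 < s := by linarith
  rcases le_total (∑ i, θ i ^ 2) (s ^ (-(1 / 2) : ℝ)) with h | h
  · refine le_add_of_le_of_nonneg (Real.exp_le_exp.2 ?_) (by positivity)
    have := mul_le_mul_of_nonneg_left (log_mul_le_neg_latticeSymbol hs h) ht.le
    linarith
  · refine le_add_of_nonneg_of_le (Real.exp_pos _).le ?_
    have h1 := mul_le_mul_of_nonneg_left (mul_sum_sq_le_neg_latticeSymbol hθ) ht.le
    have h2 : 2 / (3 * π ^ 2) = 2 * (1 / (3 * π ^ 2)) := by ring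
    rw [h2] at h1
    have h3 : t * (1 / (3 * π ^ 2)) * s ^ (-(1 / 2) : ℝ) ≤
        t * (1 / (3 * π ^ 2)) * ∑ i, θ i ^ 2 := by gcongr
    refine le_trans ?_ (mul_le_mul_of_nonneg_right (exp_neg_le_rpow (by positivity))
      (Real.exp_pos _).le)
    rw [← Real.exp_add]
    apply Real.exp_le_exp.2
    linarith

/-- On-diagonal heat kernel bound: the main term carries the logarithmic correction, and the
remainder, coming from frequencies away from the origin, decays faster in time. -/
lemma exists_pTrans_zero_le : ∃ A : ℝ, 0 ≤ A ∧ ∀ s t : ℝ, 1 < s → 0 < t →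
    pTrans 3 2 t 0 ≤ A * Real.log s ^ (-(3 / 2) : ℝ) * t ^ (-(3 / 2) : ℝ) +
      A * s ^ (1 / 8 : ℝ) * t ^ (-(7 / 4) : ℝ) := by
  set A₁ : ℝ := (π * (192 * π ^ 2)) ^ (3 / 2 : ℝ) with hA₁
  set A₂ : ℝ := (1 / (3 * π ^ 2)) ^ (-(1 / 4) : ℝ) * (π * (3 * π ^ 2)) ^ (3 / 2 : ℝ) with hA₂
  have hA₁0 : 0 ≤ A₁ := by positivity
  have hA₂0 : 0 ≤ A₂ := by positivity
  refine ⟨((2 * π) ^ 3)⁻¹ * (A₁ + A₂), by positivity, fun s t hs ht => ?_⟩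
  have hs0 : 0 < s := by linarith
  have hL : 0 < Real.log s := Real.log_pos hs
  set b₁ := t * (Real.log s / (192 * π ^ 2)) with hb₁
  set b₂ := t * (1 / (3 * π ^ 2)) with hb₂
  have hb₁0 : 0 < b₁ := by positivity
  have hb₂0 : 0 < b₂ := by positivity
  set K := (b₂ * s ^ (-(1 / 2) : ℝ)) ^ (-(1 / 4) : ℝ) with hK
  have hK0 : 0 ≤ K := by positivity
  have hint : Integrable fun θ : Fin 3 → ℝ => Real.exp (-(b₁ * ∑ i, θ i ^ 2)) +
      K * Real.exp (-(b₂ * ∑ i, θ i ^ 2)) :=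
    (integrable_exp_neg_mul_sum_sq hb₁0).add ((integrable_exp_neg_mul_sum_sq hb₂0).const_mul K)
  have hmain : ∫ θ in Set.univ.pi (fun _ : Fin 3 => Set.Icc (-π) π),
      Real.exp (t * latticeSymbol 3 2 θ) ≤
      (π / b₁) ^ (3 / 2 : ℝ) + K * (π / b₂) ^ (3 / 2 : ℝ) := by
    rw [← integral_exp_neg_mul_sum_sq hb₁0, ← integral_exp_neg_mul_sum_sq hb₂0,
      ← integral_const_mul, ← integral_add (integrable_exp_neg_mul_sum_sq hb₁0)
        ((integrable_exp_neg_mul_sum_sq hb₂0).const_mul K)]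
    refine le_trans (integral_mono_of_nonneg (ae_of_all _ fun _ => (Real.exp_pos _).le)
      hint.integrableOn ?_) (setIntegral_le_integral hint (ae_of_all _ fun _ => by positivity))
    refine (ae_restrict_iff' (MeasurableSet.univ_pi fun _ => measurableSet_Icc)).2
      (ae_of_all _ fun θ hθ => ?_)
    exact exp_mul_latticeSymbol_le (fun i => abs_le.2 (hθ i (Set.mem_univ i))) hs.le ht
  have e₁ : (π / b₁) ^ (3 / 2 : ℝ) =
      A₁ * Real.log s ^ (-(3 / 2) : ℝ) * t ^ (-(3 / 2) : ℝ) := by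
    have : π / b₁ = π * (192 * π ^ 2) * (Real.log s)⁻¹ * t⁻¹ := by
      rw [hb₁]; field_simp
    rw [this, Real.mul_rpow (by positivity) (by positivity),
      Real.mul_rpow (by positivity) (by positivity), Real.inv_rpow hL.le, Real.inv_rpow ht.le,
      Real.rpow_neg hL.le, Real.rpow_neg ht.le]
  have e₂ : K * (π / b₂) ^ (3 / 2 : ℝ) = A₂ * s ^ (1 / 8 : ℝ) * t ^ (-(7 / 4) : ℝ) := by
    have h1 : π / b₂ = π * (3 * π ^ 2) * t⁻¹ := by
      rw [hb₂]; field_simp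
    have h2 : t ^ (-(7 / 4) : ℝ) = t ^ (-(1 / 4) : ℝ) * (t ^ (3 / 2 : ℝ))⁻¹ := by
      rw [← Real.rpow_neg ht.le, ← Real.rpow_add ht]; norm_num
    have h3 : K = t ^ (-(1 / 4) : ℝ) * (1 / (3 * π ^ 2)) ^ (-(1 / 4) : ℝ) * s ^ (1 / 8 : ℝ) := by
      rw [hK, hb₂, Real.mul_rpow (by positivity) (by positivity),
        Real.mul_rpow (by positivity) (by positivity), ← Real.rpow_mul hs0.le]
      norm_num
    rw [h1, h2, h3, Real.mul_rpow (by positivity) (by positivity), Real.inv_rpow ht.le, hA₂]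
    ring
  rw [pTrans_zero]
  calc _ ≤ ((2 * π) ^ 3)⁻¹ * (A₁ * Real.log s ^ (-(3 / 2) : ℝ) * t ^ (-(3 / 2) : ℝ) +
        A₂ * s ^ (1 / 8 : ℝ) * t ^ (-(7 / 4) : ℝ)) := by
        rw [← e₁, ← e₂]; gcongr
    _ ≤ ((2 * π) ^ 3)⁻¹ *
        ((A₁ + A₂) * Real.log s ^ (-(3 / 2) : ℝ) * t ^ (-(3 / 2) : ℝ) +
          (A₁ + A₂) * s ^ (1 / 8 : ℝ) * t ^ (-(7 / 4) : ℝ)) := by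
        gcongr <;> linarith
    _ = _ := by ring

lemma integrableOn_Ioi_add_left_rpow {α τ : ℝ} (hα : α < -1) (hτ : 0 < τ) :
    IntegrableOn (fun v : ℝ => (τ + v) ^ α) (Set.Ioi 0) := by
  simpa [add_comm] using integrableOn_add_rpow_Ioi_of_lt (m := τ) (c := 0) hα (by linarith)

lemma integral_Ioi_add_left_rpow {α τ : ℝ} (hα : α < -1) (hτ : 0 < τ) :
    ∫ v in Set.Ioi (0 : ℝ), (τ + v) ^ α = -τ ^ (α + 1) / (α + 1) := by
  rw [← integral_Ioi_rpow_of_lt hα hτ,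
    ← (measurePreserving_add_left volume τ).setIntegral_preimage_emb
      (measurableEmbedding_addLeft τ) (fun x => x ^ α)]
  simp

lemma integrableOn_Icc_rpow {β r : ℝ} (hβ : -1 < β) (hr : 0 ≤ r) :
    IntegrableOn (fun τ : ℝ => τ ^ β) (Set.Icc 0 r) := by
  rw [← intervalIntegrable_iff_integrableOn_Icc_of_le hr]
  exact intervalIntegral.intervalIntegrable_rpow' hβ

lemma integral_Icc_rpow {β r : ℝ} (hβ : -1 < β) (hr : 0 ≤ r) :
    ∫ τ in Set.Icc 0 r, τ ^ β = r ^ (β + 1) / (β + 1) := by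
  rw [integral_Icc_eq_integral_Ioc, ← intervalIntegral.integral_of_le hr,
    integral_rpow (Or.inl hβ), Real.zero_rpow (by linarith), sub_zero]

lemma ae_restrict_Icc_of_forall_pos {r : ℝ} {P : ℝ → Prop} (h : ∀ τ, 0 < τ → P τ) :
    ∀ᵐ τ ∂(volume.restrict (Set.Icc 0 r)), P τ := by
  rw [← restrict_Ioc_eq_restrict_Icc]
  exact (ae_restrict_iff' measurableSet_Ioc).2 (ae_of_all _ fun τ hτ => h τ hτ.1)

lemma triple_integral_le {p : ℝ → ℝ} (hp : ∀ t, 0 ≤ p t) {a b : ℝ}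
    (h : ∀ t, 0 < t → p t ≤ a * t ^ (-(3 / 2) : ℝ) + b * t ^ (-(7 / 4) : ℝ)) {s : ℝ}
    (hs : 0 ≤ s) :
    ∫ r in Set.Icc (0 : ℝ) s, ∫ θ in Set.Icc (0 : ℝ) r, ∫ v in Set.Ioi (0 : ℝ), p (θ + v) ≤
      8 / 3 * a * s ^ (3 / 2 : ℝ) + 64 / 15 * b * s ^ (5 / 4 : ℝ) := by
  have h1 : ∀ τ, 0 < τ → ∫ v in Set.Ioi (0 : ℝ), p (τ + v) ≤
      2 * a * τ ^ (-(1 / 2) : ℝ) + 4 / 3 * b * τ ^ (-(3 / 4) : ℝ) := fun τ hτ => by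
    have i₁ := (integrableOn_Ioi_add_left_rpow (α := -(3 / 2)) (by norm_num) hτ).const_mul a
    have i₂ := (integrableOn_Ioi_add_left_rpow (α := -(7 / 4)) (by norm_num) hτ).const_mul b
    refine (integral_mono_of_nonneg (ae_of_all _ fun v => hp _) (i₁.add i₂)
      ((ae_restrict_iff' measurableSet_Ioi).2 (ae_of_all _ fun v hv =>
        h (τ + v) (add_pos hτ hv)))).trans_eq ?_
    simp only [Pi.add_apply]
    rw [integral_add i₁ i₂, integral_const_mul, integral_const_mul,
      integral_Ioi_add_left_rpow (by norm_num) hτ, integral_Ioi_add_left_rpow (by norm_num) hτ]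
    norm_num
    ring
  have h2 : ∀ r, 0 < r → ∫ θ in Set.Icc (0 : ℝ) r, ∫ v in Set.Ioi (0 : ℝ), p (θ + v) ≤
      4 * a * r ^ (1 / 2 : ℝ) + 16 / 3 * b * r ^ (1 / 4 : ℝ) := fun r hr => by
    have i₁ := (integrableOn_Icc_rpow (β := -(1 / 2)) (by norm_num) hr.le).const_mul (2 * a)
    have i₂ := (integrableOn_Icc_rpow (β := -(3 / 4)) (by norm_num) hr.le).const_mul (4 / 3 * b)
    refine (integral_mono_of_nonneg (ae_of_all _ fun θ => integral_nonneg fun v => hp _)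
      (i₁.add i₂) (ae_restrict_Icc_of_forall_pos h1)).trans_eq ?_
    simp only [Pi.add_apply]
    rw [integral_add i₁ i₂, integral_const_mul, integral_const_mul,
      integral_Icc_rpow (by norm_num) hr.le, integral_Icc_rpow (by norm_num) hr.le]
    norm_num
    ring
  have i₁ := (integrableOn_Icc_rpow (β := 1 / 2) (by norm_num) hs).const_mul (4 * a)
  have i₂ := (integrableOn_Icc_rpow (β := 1 / 4) (by norm_num) hs).const_mul (16 / 3 * b)
  refine (integral_mono_of_nonneg
    (ae_of_all _ fun r => integral_nonneg fun θ => integral_nonneg fun v => hp _)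
    (i₁.add i₂) (ae_restrict_Icc_of_forall_pos h2)).trans_eq ?_
  simp only [Pi.add_apply]
  rw [integral_add i₁ i₂, integral_const_mul, integral_const_mul,
    integral_Icc_rpow (by norm_num) hs, integral_Icc_rpow (by norm_num) hs]
  norm_num
  ring

lemma rpow_le_mul_log_rpow {s : ℝ} (hs : 1 < s) :
    s ^ (11 / 8 : ℝ) ≤ 12 ^ (3 / 2 : ℝ) * (s ^ (3 / 2 : ℝ) * Real.log s ^ (-(3 / 2) : ℝ)) := by
  have hs0 : 0 < s := by linarith
  have hL : 0 < Real.log s := Real.log_pos hs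
  have h1 : Real.log s ≤ 12 * s ^ (1 / 12 : ℝ) := by
    have := Real.log_le_rpow_div hs0.le (by norm_num : (0 : ℝ) < 1 / 12)
    linarith
  have h2 : Real.log s ^ (3 / 2 : ℝ) ≤ 12 ^ (3 / 2 : ℝ) * s ^ (1 / 8 : ℝ) := by
    refine (Real.rpow_le_rpow hL.le h1 (by norm_num)).trans_eq ?_
    rw [Real.mul_rpow (by norm_num) (by positivity), ← Real.rpow_mul hs0.le]
    norm_num
  have h3 : s ^ (3 / 2 : ℝ) = s ^ (11 / 8 : ℝ) * s ^ (1 / 8 : ℝ) := by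
    rw [← Real.rpow_add hs0]; norm_num
  rw [Real.rpow_neg hL.le, ← div_eq_mul_inv, mul_div_assoc', le_div_iff₀ (by positivity), h3]
  have h4 := mul_le_mul_of_nonneg_left h2 (by positivity : 0 ≤ s ^ (11 / 8 : ℝ))
  linarith

/-- **Triple integral bound in the critical case `d = 3, α = 2` (equation 5.8)**:
there is a constant `C` such that for all `s ≥ 1000`,
`∫_0^s ∫_0^r ∫_0^∞ p_{θ+v}^{3,2}(0,0) dv dθ dr ≤ C s^{3/2} (log s)^{−3/2}`. -/
theorem triple_integral_bound_d3 :
    ∃ C : ℝ, ∀ s : ℝ, 1000 ≤ s →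
      (∫ r in Set.Icc (0 : ℝ) s, ∫ θ in Set.Icc (0 : ℝ) r,
          ∫ v in Set.Ioi (0 : ℝ), pTrans 3 2 (θ + v) (0 : Fin 3 → ℤ)) ≤
        C * s ^ ((3 : ℝ) / 2) * Real.log s ^ (-(3 : ℝ) / 2) := by
  obtain ⟨A, hA, hbound⟩ := exists_pTrans_zero_le
  refine ⟨8 / 3 * A + 64 / 15 * A * 12 ^ (3 / 2 : ℝ), fun s hs => ?_⟩
  have hs1 : 1 < s := by linarith
  have hs0 : 0 < s := by linarith
  refine (triple_integral_le (pTrans_zero_nonneg 3 2) (fun t ht => hbound s t hs1 ht)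
    hs0.le).trans ?_
  have h1 : s ^ (1 / 8 : ℝ) * s ^ (5 / 4 : ℝ) = s ^ (11 / 8 : ℝ) := by
    rw [← Real.rpow_add hs0]; norm_num
  have h2 := mul_le_mul_of_nonneg_left (rpow_le_mul_log_rpow hs1) hA
  rw [← h1] at h2
  rw [neg_div]
  linarith
end

section
/- Explicit covariance integral (from the proof of Lemma 4.6): for d ∈ {1,2,3}, α ∈ (d/2, min(d,2)) and reals 0 < t₁ ≤ t₂, ∫_0^{t₁} ( ∫_0^{t₁−s} ( ∫_0^{t₂−s} (r+v)^{−d/α} dr ) dv ) ds = ( α³ / ((d−α)(2α−d)(3α−d)) ) · ( t₂^{3−d/α} + t₁^{3−d/α} − (t₁+t₂)^{3−d/α}/2 − (t₂−t₁)^{3−d/α}/2 ), and all the integrals involved are finite. -/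
open MeasureTheory Filter Topology

lemma setIntegral_Icc_eq_intervalIntegral {a b : ℝ} (hab : a ≤ b) (f : ℝ → ℝ) :
    ∫ x in Set.Icc a b, f x = ∫ x in a..b, f x := by
  rw [integral_Icc_eq_integral_Ioc, intervalIntegral.integral_of_le hab]

lemma add_rpow_neg_le_mul_rpow {β r v : ℝ} (hβ : 0 ≤ β) (hr : 0 < r) (hv : 0 < v) :
    (r + v) ^ (-β) ≤ v ^ (-β / 2) * r ^ (-β / 2) := by
  have hsplit : (r + v) ^ (-β) = (r + v) ^ (-β / 2) * (r + v) ^ (-β / 2) := by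
    rw [← Real.rpow_add (by positivity)]
    congr 1
    ring
  rw [hsplit]
  have hexp : -β / 2 ≤ 0 := by linarith
  gcongr ?_ * ?_
  · exact Real.rpow_le_rpow_of_nonpos hv (by linarith) hexp
  · exact Real.rpow_le_rpow_of_nonpos hr (by linarith) hexp

lemma integrableOn_add_rpow_neg_prod {β : ℝ} (hβ0 : 0 ≤ β) (hβ2 : β < 2) {a b c : ℝ}
    (hb : 0 ≤ b) (hc : 0 ≤ c) :
    IntegrableOn (fun q : ℝ × ℝ × ℝ => (q.2.2 + q.2.1) ^ (-β))
      (Set.Icc 0 a ×ˢ (Set.Icc 0 b ×ˢ Set.Icc 0 c)) := by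
  have hpow : ∀ x : ℝ, 0 ≤ x →
      Integrable (fun y : ℝ => y ^ (-β / 2)) (volume.restrict (Set.Ioc 0 x)) := fun x hx =>
    (intervalIntegrable_iff_integrableOn_Ioc_of_le hx).1
      (intervalIntegral.intervalIntegrable_rpow' (by linarith))
  have hmul := (integrable_const (μ := volume.restrict (Set.Icc (0 : ℝ) a)) (1 : ℝ)).mul_prod
    ((hpow b hb).mul_prod (hpow c hc))
  have hvol : (volume : Measure (ℝ × ℝ × ℝ)).restrict
        (Set.Icc 0 a ×ˢ (Set.Icc 0 b ×ˢ Set.Icc 0 c)) =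
      (volume.restrict (Set.Icc 0 a)).prod
        ((volume.restrict (Set.Ioc 0 b)).prod (volume.restrict (Set.Ioc 0 c))) := by
    rw [Measure.volume_eq_prod, ← Measure.prod_restrict, Measure.volume_eq_prod,
      ← Measure.prod_restrict, restrict_Ioc_eq_restrict_Icc, restrict_Ioc_eq_restrict_Icc]
  rw [IntegrableOn, hvol]
  refine hmul.mono' (Measurable.aestronglyMeasurable (by fun_prop)) ?_
  rw [Measure.prod_restrict, Measure.prod_restrict]
  filter_upwards [ae_restrict_mem
    (measurableSet_Icc.prod (measurableSet_Ioc.prod measurableSet_Ioc))] with q hq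
  obtain ⟨-, hv, hr⟩ := hq
  have hsum : 0 < q.2.2 + q.2.1 := add_pos hr.1 hv.1
  rw [Real.norm_of_nonneg (by positivity), one_mul]
  exact add_rpow_neg_le_mul_rpow hβ0 hr.1 hv.1

lemma integral_add_rpow_neg {β v b : ℝ} (hβ : β ≠ 1) (hv : 0 < v) (hb : 0 ≤ b) :
    ∫ r in (0 : ℝ)..b, (r + v) ^ (-β) = ((b + v) ^ (1 - β) - v ^ (1 - β)) / (1 - β) := by
  rw [intervalIntegral.integral_comp_add_right (fun x : ℝ => x ^ (-β)), zero_add,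
    integral_rpow, neg_add_eq_sub]
  refine Or.inr ⟨fun h => hβ (by linarith), ?_⟩
  rw [Set.uIcc_of_le (by linarith)]
  exact fun h => hv.not_ge h.1

lemma integral_integral_add_rpow_neg {β a b : ℝ} (hβ : β ≠ 1) (hβ2 : β < 2)
    (ha : 0 ≤ a) (hb : 0 ≤ b) :
    ∫ v in Set.Icc (0 : ℝ) a, ∫ r in Set.Icc (0 : ℝ) b, (r + v) ^ (-β) =
      ((a + b) ^ (2 - β) - b ^ (2 - β) - a ^ (2 - β)) / ((1 - β) * (2 - β)) := by
  have hinner : ∀ v ∈ Set.Ioc (0 : ℝ) a, ∫ r in Set.Icc (0 : ℝ) b, (r + v) ^ (-β) =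
      ((v + b) ^ (1 - β) - v ^ (1 - β)) / (1 - β) := fun v hv => by
    rw [setIntegral_Icc_eq_intervalIntegral hb, integral_add_rpow_neg hβ hv.1 hb, add_comm b v]
  have hexp : -1 < 1 - β := by linarith
  have hint : ∀ x y : ℝ, IntervalIntegrable (fun v : ℝ => v ^ (1 - β)) volume x y := fun _ _ =>
    intervalIntegral.intervalIntegrable_rpow' hexp
  have hshift : IntervalIntegrable (fun v : ℝ => (v + b) ^ (1 - β)) volume 0 a := by
    simpa using (hint (0 + b) (a + b)).comp_add_right b
  rw [integral_Icc_eq_integral_Ioc, setIntegral_congr_fun measurableSet_Ioc hinner,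
    ← intervalIntegral.integral_of_le ha, intervalIntegral.integral_div,
    intervalIntegral.integral_sub hshift (hint 0 a),
    intervalIntegral.integral_comp_add_right (fun x : ℝ => x ^ (1 - β)),
    integral_rpow (Or.inl hexp), integral_rpow (Or.inl hexp),
    show 1 - β + 1 = 2 - β by ring, Real.zero_rpow (by linarith), zero_add]
  have h1 : 1 - β ≠ 0 := sub_ne_zero.2 hβ.symm
  have h2 : 2 - β ≠ 0 := by linarith
  field_simp
  ring

lemma integral_sub_rpow {p c t : ℝ} (hp : -1 < p) :
    ∫ s in (0 : ℝ)..t, (c - s) ^ p = (c ^ (p + 1) - (c - t) ^ (p + 1)) / (p + 1) := by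
  rw [intervalIntegral.integral_comp_sub_left (fun x : ℝ => x ^ p), integral_rpow (Or.inl hp),
    sub_zero]

lemma integral_sub_two_mul_rpow {p c t : ℝ} (hp : -1 < p) :
    ∫ s in (0 : ℝ)..t, (c - 2 * s) ^ p =
      (c ^ (p + 1) - (c - 2 * t) ^ (p + 1)) / (2 * (p + 1)) := by
  rw [intervalIntegral.integral_comp_sub_mul (fun x : ℝ => x ^ p) two_ne_zero,
    integral_rpow (Or.inl hp), mul_zero, sub_zero, smul_eq_mul]
  have : p + 1 ≠ 0 := by linarith
  field_simp

lemma integral_integral_integral_add_rpow_neg {β t₁ t₂ : ℝ} (hβ : β ≠ 1) (hβ2 : β < 2)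
    (ht₁ : 0 ≤ t₁) (ht : t₁ ≤ t₂) :
    ∫ s in Set.Icc (0 : ℝ) t₁, ∫ v in Set.Icc (0 : ℝ) (t₁ - s),
        ∫ r in Set.Icc (0 : ℝ) (t₂ - s), (r + v) ^ (-β) =
      (t₂ ^ (3 - β) + t₁ ^ (3 - β) - (t₁ + t₂) ^ (3 - β) / 2 - (t₂ - t₁) ^ (3 - β) / 2) /
        ((β - 1) * (2 - β) * (3 - β)) := by
  have hinner : ∀ s ∈ Set.Icc (0 : ℝ) t₁, ∫ v in Set.Icc (0 : ℝ) (t₁ - s),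
        ∫ r in Set.Icc (0 : ℝ) (t₂ - s), (r + v) ^ (-β) =
      ((t₁ + t₂ - 2 * s) ^ (2 - β) - (t₂ - s) ^ (2 - β) - (t₁ - s) ^ (2 - β)) /
        ((1 - β) * (2 - β)) := fun s hs => by
    rw [integral_integral_add_rpow_neg hβ hβ2 (by linarith [hs.2]) (by linarith [hs.2]),
      show t₁ - s + (t₂ - s) = t₁ + t₂ - 2 * s by ring]
  have hexp : 0 ≤ 2 - β := by linarith
  have hcont : ∀ f : ℝ → ℝ, Continuous f →
      IntervalIntegrable (fun s : ℝ => f s ^ (2 - β)) volume 0 t₁ := fun f hf =>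
    (hf.rpow_const fun _ => Or.inr hexp).intervalIntegrable 0 t₁
  rw [setIntegral_congr_fun measurableSet_Icc hinner, setIntegral_Icc_eq_intervalIntegral ht₁,
    intervalIntegral.integral_div,
    intervalIntegral.integral_sub ((hcont _ (by fun_prop)).sub (hcont _ (by fun_prop)))
      (hcont _ (by fun_prop)),
    intervalIntegral.integral_sub (hcont _ (by fun_prop)) (hcont _ (by fun_prop)),
    integral_sub_two_mul_rpow (by linarith), integral_sub_rpow (by linarith),
    integral_sub_rpow (by linarith), show 2 - β + 1 = 3 - β by ring, sub_self,
    Real.zero_rpow (by linarith), show t₁ + t₂ - 2 * t₁ = t₂ - t₁ by ring]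
  have h1 : 1 - β ≠ 0 := sub_ne_zero.2 hβ.symm
  have h1' : β - 1 ≠ 0 := sub_ne_zero.2 hβ
  have h2 : 2 - β ≠ 0 := by linarith
  have h3 : 3 - β ≠ 0 := by linarith
  field_simp
  ring

/-- **Explicit covariance integral (from the proof of Lemma 4.6)**: for `d ∈ {1,2,3}`,
`α ∈ (d/2, min(d,2))` and `0 < t₁ ≤ t₂`,
`∫_0^{t₁} ∫_0^{t₁−s} ∫_0^{t₂−s} (r+v)^{−d/α} dr dv ds
  = α³/((d−α)(2α−d)(3α−d)) (t₂^{3−d/α} + t₁^{3−d/α} − (t₁+t₂)^{3−d/α}/2 − (t₂−t₁)^{3−d/α}/2)`,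
all the integrals involved being finite. -/
theorem explicit_covariance_integral (d : ℕ) (hd1 : 1 ≤ d) (hd3 : d ≤ 3)
    (α : ℝ) (hα1 : (d : ℝ) / 2 < α) (hα2 : α < min (d : ℝ) 2)
    (t₁ t₂ : ℝ) (ht₁ : 0 < t₁) (ht : t₁ ≤ t₂) :
    IntegrableOn (fun q : ℝ × ℝ × ℝ => (q.2.2 + q.2.1) ^ (-(d : ℝ) / α))
      {q : ℝ × ℝ × ℝ | q.1 ∈ Set.Icc 0 t₁ ∧ q.2.1 ∈ Set.Icc 0 (t₁ - q.1) ∧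
        q.2.2 ∈ Set.Icc 0 (t₂ - q.1)} ∧
    (∫ s in Set.Icc (0 : ℝ) t₁, ∫ v in Set.Icc (0 : ℝ) (t₁ - s),
        ∫ r in Set.Icc (0 : ℝ) (t₂ - s), (r + v) ^ (-(d : ℝ) / α)) =
      α ^ 3 / (((d : ℝ) - α) * (2 * α - (d : ℝ)) * (3 * α - (d : ℝ))) *
        (t₂ ^ (3 - (d : ℝ) / α) + t₁ ^ (3 - (d : ℝ) / α)
          - (t₁ + t₂) ^ (3 - (d : ℝ) / α) / 2 - (t₂ - t₁) ^ (3 - (d : ℝ) / α) / 2) := by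
  have hd : (1 : ℝ) ≤ d := by exact_mod_cast hd1
  have hα : 0 < α := by linarith
  have hαd : α < d := hα2.trans_le (min_le_left _ _)
  have hβ1 : 1 < (d : ℝ) / α := by rwa [one_lt_div hα]
  have hβ2 : (d : ℝ) / α < 2 := by
    rw [div_lt_iff₀ hα]
    linarith
  simp only [neg_div]
  refine ⟨(integrableOn_add_rpow_neg_prod (a := t₁) (by linarith) hβ2 ht₁.le
    (ht₁.le.trans ht)).mono_set ?_, ?_⟩
  · rintro q ⟨hs, hv, hr⟩
    exact ⟨hs, ⟨hv.1, by linarith [hv.2, hs.1]⟩, ⟨hr.1, by linarith [hr.2, hs.1]⟩⟩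
  · rw [integral_integral_integral_add_rpow_neg hβ1.ne' hβ2 ht₁.le ht]
    have hcoeff : ((d : ℝ) / α - 1) * (2 - (d : ℝ) / α) * (3 - (d : ℝ) / α) =
        ((d : ℝ) - α) * (2 * α - (d : ℝ)) * (3 * α - (d : ℝ)) / α ^ 3 := by
      field_simp
    rw [hcoeff, div_div_eq_mul_div, mul_comm, mul_div_right_comm, mul_comm (α ^ 3 / _)]
end
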